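/- arXiv:2005.11559 — 3 statements merged into one kernel-verified Lean document; each statement's English description precedes it below -/
import Mathlib

section
/- Fix an integer k > 3 and assume Hypothesis (U-k). Then for every real α with 0 < α < 1/11 there exist constants c > 0 and C₁ ≥ 1 (depending only on k, α and the constant in (U-k)) such that the following holds. Let A be a set of k-th powers, let H ⊆ ℤ be a finite set with A ⊆ H and |H| ≥ 2, and let K ≥ 2 be such that |H + H| ≤ K·|H| and log K ≤ (log |H|)^α. Then |A| ≤ C₁·|H|^{1/2}·exp(−c·(log |H| / (log K)²)^{1/3}). -/
open Finset Pointwise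

/-- Hypothesis (U-k): an instance of the Uniformity Conjecture for the curves
`y^k = x^k + a` with `a ≠ 0`. -/
def Uk (k : ℕ) (C : ℕ) : Prop :=
  ∀ a : ℤ, a ≠ 0 →
    {p : ℚ × ℚ | p.2 ^ k = p.1 ^ k + (a : ℚ)}.Finite ∧
    {p : ℚ × ℚ | p.2 ^ k = p.1 ^ k + (a : ℚ)}.ncard ≤ C

/-- **Plünnecke–Ruzsa** for a set of integers with real doubling constant. -/
theorem card_nsmul_sub_nsmul_le {H : Finset ℤ} (hH : H.Nonempty) {K : ℝ}
    (hd : ((H + H).card : ℝ) ≤ K * H.card) (m n : ℕ) :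
    ((m • H - n • H).card : ℝ) ≤ K ^ (m + n) * H.card := by
  have h := pluennecke_ruzsa_inequality_nsmul_sub_nsmul_add hH H m n
  have h' : ((m • H - n • H).card : ℝ) ≤ ((H + H).card / H.card : ℝ) ^ (m + n) * H.card := by
    have := (NNRat.cast_le (K := ℝ)).2 h
    push_cast at this
    exact this
  have hpos : (0 : ℝ) < H.card := by exact_mod_cast hH.card_pos
  refine h'.trans ?_
  gcongr
  rwa [div_le_iff₀ hpos]

/-- Sums of dyadic dilates of a set of small doubling are small. -/
theorem card_two_pow_dilate_add_le {H : Finset ℤ} (hH : H.Nonempty) {K : ℝ} (hK : 0 ≤ K)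
    (hd : ((H + H).card : ℝ) ≤ K * H.card) (i : ℕ) :
    ((H.image (fun x => 2 ^ i * x) + H).card : ℝ) ≤ K ^ (3 * i + 1) * H.card := by
  have hpos : (0 : ℝ) < H.card := by exact_mod_cast hH.card_pos
  induction i with
  | zero => simpa using hd
  | succ i ih =>
    set B := H.image (fun x : ℤ => 2 ^ i * x) with hB
    set A := H.image (fun x : ℤ => 2 ^ (i + 1) * x) with hA
    have hBc : B.card = H.card :=
      card_image_of_injective _ fun x y h => by simpa using h
    have hsub : A + B ⊆ (3 • H - 0 • H).image (fun x : ℤ => 2 ^ i * x) := by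
      intro z hz
      obtain ⟨a, ha, b, hb, rfl⟩ := mem_add.1 hz
      obtain ⟨x, hx, rfl⟩ := mem_image.1 ha
      obtain ⟨y, hy, rfl⟩ := mem_image.1 hb
      refine mem_image.2 ⟨x + x + y, ?_, by ring⟩
      rw [zero_nsmul, sub_zero, show 3 • H = H + H + H by simp [succ_nsmul]]
      exact add_mem_add (add_mem_add hx hx) hy
    have h1 : ((A + B).card : ℝ) ≤ K ^ 3 * H.card := by
      refine le_trans ?_ (card_nsmul_sub_nsmul_le hH hd 3 0)
      exact_mod_cast (card_le_card hsub).trans card_image_le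
    have h2 : ((A + H).card * B.card : ℝ) ≤ (A + B).card * (B + H).card := by
      exact_mod_cast ruzsa_triangle_inequality_add_add_add A B H
    rw [hBc] at h2
    have h3 : ((A + B).card * (B + H).card : ℝ) ≤
        (K ^ 3 * H.card) * (K ^ (3 * i + 1) * H.card) := by gcongr
    refine le_of_mul_le_mul_right ((h2.trans h3).trans_eq ?_) hpos
    ring

/-- Exponential moment of a centred bounded function on a finite set. -/
theorem sum_exp_mul_sub_average_le {H : Finset ℤ} (hH : H.Nonempty) (g : ℤ → ℝ)
    (hg0 : ∀ h, 0 ≤ g h) (hg1 : ∀ h, g h ≤ 1) {μ : ℝ} (hμ : |μ| ≤ 1) :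
    ∑ h ∈ H, Real.exp (μ * (g h - (∑ x ∈ H, g x) / H.card)) ≤
      H.card * Real.exp (μ ^ 2) := by
  have hpos : (0 : ℝ) < H.card := by exact_mod_cast hH.card_pos
  set f := (∑ x ∈ H, g x) / H.card with hf
  have hf0 : 0 ≤ f := div_nonneg (sum_nonneg fun x _ => hg0 x) hpos.le
  have hf1 : f ≤ 1 := by
    rw [hf, div_le_one hpos]
    exact (sum_le_sum fun x _ => hg1 x).trans (by simp)
  have key : ∀ h ∈ H, Real.exp (μ * (g h - f)) ≤ 1 + μ * (g h - f) + μ ^ 2 := by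
    intro h _
    have habs : |g h - f| ≤ 1 := abs_le.2 ⟨by linarith [hg0 h], by linarith [hg1 h]⟩
    have h1 : |μ * (g h - f)| ≤ 1 := by
      rw [abs_mul]; exact mul_le_one₀ hμ (abs_nonneg _) habs
    have h2 := (abs_le.1 (Real.abs_exp_sub_one_sub_id_le h1)).2
    have h3 : (μ * (g h - f)) ^ 2 ≤ μ ^ 2 := by
      rw [mul_pow]
      exact mul_le_of_le_one_right (sq_nonneg _) ((sq_le_one_iff_abs_le_one _).2 habs)
    linarith
  refine (sum_le_sum key).trans ?_
  have hz : ∑ h ∈ H, (g h - f) = 0 := by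
    rw [sum_sub_distrib, sum_const, nsmul_eq_mul, hf]; field_simp; ring
  rw [sum_add_distrib, sum_add_distrib, ← mul_sum, hz]
  simp only [sum_const, nsmul_eq_mul]
  nlinarith [Real.add_one_le_exp (μ ^ 2)]

/-- Exponential moment of the empirical average of `m` independent samples. -/
theorem sum_piFinset_exp_le {H : Finset ℤ} (hH : H.Nonempty) (g : ℤ → ℝ)
    (hg0 : ∀ h, 0 ≤ g h) (hg1 : ∀ h, g h ≤ 1) {m : ℕ} (hm : 0 < m) {l : ℝ} (hl : |l| ≤ m) :
    ∑ a ∈ Fintype.piFinset (fun _ : Fin m => H),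
        Real.exp (l * ((∑ j, g (a j)) / m - (∑ x ∈ H, g x) / H.card)) ≤
      H.card ^ m * Real.exp (l ^ 2 / m) := by
  have hm' : (0 : ℝ) < m := by exact_mod_cast hm
  set f := (∑ x ∈ H, g x) / H.card with hf
  have h1 : ∀ a : Fin m → ℤ, Real.exp (l * ((∑ j, g (a j)) / m - f)) =
      ∏ j, Real.exp (l / m * (g (a j) - f)) := by
    intro a
    rw [← Real.exp_sum, ← mul_sum, sum_sub_distrib]
    congr 1
    simp
    field_simp
  simp_rw [h1]
  rw [← Finset.sum_pow' H (fun h => Real.exp (l / m * (g h - f))) m]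
  have hμ : |l / m| ≤ 1 := by
    rw [abs_div, abs_of_pos hm']; exact (div_le_one hm').2 hl
  calc _ ≤ (H.card * Real.exp ((l / m) ^ 2)) ^ m := by
        gcongr
        exact sum_exp_mul_sub_average_le hH g hg0 hg1 hμ
    _ = _ := by
        rw [mul_pow, ← Real.exp_nat_mul]
        congr 2
        field_simp

/-- The proportion of `h ∈ H` with `x + h ∈ S`. -/
noncomputable def shiftDensity (H S : Finset ℤ) (x : ℤ) : ℝ :=
  (∑ h ∈ H, if x + h ∈ S then (1 : ℝ) else 0) / H.card

/-- The proportion of the sample points `a j` with `x + a j ∈ S`. -/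
noncomputable def sampleDensity {m : ℕ} (S : Finset ℤ) (a : Fin m → ℤ) (x : ℤ) : ℝ :=
  (∑ j, if x + a j ∈ S then (1 : ℝ) else 0) / m

/-- Two-sided exponential deviation of a sample, summed over `D`. -/
noncomputable def expDeviation {m : ℕ} (H S D : Finset ℤ) (l : ℝ) (a : Fin m → ℤ) : ℝ :=
  ∑ x ∈ D, (Real.exp (l * (sampleDensity S a x - shiftDensity H S x)) +
    Real.exp (-l * (sampleDensity S a x - shiftDensity H S x)))

theorem sum_expDeviation_le {H : Finset ℤ} (hH : H.Nonempty) (S D : Finset ℤ) {m : ℕ}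
    (hm : 0 < m) {l : ℝ} (hl : |l| ≤ m) :
    ∑ a ∈ Fintype.piFinset (fun _ : Fin m => H), expDeviation H S D l a ≤
      2 * D.card * Real.exp (l ^ 2 / m) * H.card ^ m := by
  unfold expDeviation
  rw [sum_comm]
  have key : ∀ x ∈ D, ∑ a ∈ Fintype.piFinset (fun _ : Fin m => H),
      (Real.exp (l * (sampleDensity S a x - shiftDensity H S x)) +
        Real.exp (-l * (sampleDensity S a x - shiftDensity H S x))) ≤
      2 * Real.exp (l ^ 2 / m) * H.card ^ m := by
    intro x _
    have h0 : ∀ h : ℤ, (0 : ℝ) ≤ if x + h ∈ S then (1 : ℝ) else 0 := by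
      intro h; split_ifs <;> norm_num
    have h1 : ∀ h : ℤ, (if x + h ∈ S then (1 : ℝ) else 0) ≤ 1 := by
      intro h; split_ifs <;> norm_num
    have e1 := sum_piFinset_exp_le hH _ h0 h1 hm hl
    have e2 := sum_piFinset_exp_le hH _ h0 h1 hm (l := -l) (by rwa [abs_neg])
    rw [sum_add_distrib]
    rw [neg_sq] at e2
    unfold sampleDensity shiftDensity
    linarith
  refine (sum_le_sum key).trans_eq ?_
  rw [sum_const, nsmul_eq_mul]
  ring

/-- Many translates of one tuple are samples with small deviation. -/
theorem exists_shifts_of_good_samples {H : Finset ℤ} (hH : H.Nonempty) {K : ℝ}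
    (hd : ((H + H).card : ℝ) ≤ K * H.card) (S D : Finset ℤ) {m : ℕ}
    (hm : 0 < m) {l : ℝ} (hl : |l| ≤ m) :
    ∃ b : Fin m → ℤ, ∃ Z ⊆ H, (H.card : ℝ) ≤ 2 * K ^ m * Z.card ∧
      ∀ z ∈ Z, (∀ j, b j - z ∈ H) ∧
        expDeviation H S D l (fun j => b j - z) ≤ 4 * D.card * Real.exp (l ^ 2 / m) := by
  classical
  have hpos : (0 : ℝ) < H.card := by exact_mod_cast hH.card_pos
  have hK : 0 < K := by
    have : (0 : ℝ) < (H + H).card := by exact_mod_cast (hH.add hH).card_pos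
    exact pos_of_mul_pos_left (this.trans_le hd) hpos.le
  set P := Fintype.piFinset (fun _ : Fin m => H) with hP
  set M := 4 * D.card * Real.exp (l ^ 2 / m) with hM
  set G := P.filter (fun a => expDeviation H S D l a ≤ M) with hG
  have hPc : (P.card : ℝ) = H.card ^ m := by
    rw [hP, Fintype.card_piFinset]; simp
  have hnn : ∀ a : Fin m → ℤ, 0 ≤ expDeviation H S D l a := fun a =>
    sum_nonneg fun x _ => by positivity
  have hGc : (H.card : ℝ) ^ m ≤ 2 * G.card := by
    have hsum := sum_expDeviation_le hH S D hm hl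
    rcases D.eq_empty_or_nonempty with rfl | hD
    · have : G = P := by
        rw [hG, filter_true_of_mem]; intro a _; simp [expDeviation, hM]
      rw [this, hPc]; linarith [pow_nonneg hpos.le m]
    have hMpos : 0 < M := by
      have : (0 : ℝ) < D.card := by exact_mod_cast hD.card_pos
      positivity
    have hbad : M * ((P.filter (fun a => ¬ expDeviation H S D l a ≤ M)).card : ℝ) ≤
        ∑ a ∈ P, expDeviation H S D l a := by
      calc _ = ∑ a ∈ P.filter (fun a => ¬ expDeviation H S D l a ≤ M), M := by
            rw [sum_const, nsmul_eq_mul, mul_comm]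
        _ ≤ ∑ a ∈ P.filter (fun a => ¬ expDeviation H S D l a ≤ M), expDeviation H S D l a :=
            sum_le_sum fun a ha => (not_le.1 (mem_filter.1 ha).2).le
        _ ≤ _ := sum_le_sum_of_subset_of_nonneg (filter_subset _ _) fun a _ _ => hnn a
    have hsplit : (P.card : ℝ) = G.card +
        (P.filter (fun a => ¬ expDeviation H S D l a ≤ M)).card := by
      exact_mod_cast (card_filter_add_card_filter_not (s := P) _).symm
    have h2 : M * ((P.filter (fun a => ¬ expDeviation H S D l a ≤ M)).card : ℝ) ≤
        M * (H.card ^ m / 2) := by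
      refine (hbad.trans hsum).trans_eq ?_
      rw [hM]; ring
    have h3 := le_of_mul_le_mul_left h2 hMpos
    rw [hPc] at hsplit
    linarith
  set T := Fintype.piFinset (fun _ : Fin m => H + H) with hT
  have hTc : (T.card : ℝ) = (H + H).card ^ m := by
    rw [hT, Fintype.card_piFinset]; simp
  have hTne : T.Nonempty := Fintype.piFinset_nonempty.2 fun _ => hH.add hH
  have hmaps : ∀ p ∈ H ×ˢ G, (fun j => p.2 j + p.1) ∈ T := by
    intro p hp
    rw [mem_product] at hp
    have := Fintype.mem_piFinset.1 (mem_filter.1 hp.2).1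
    exact Fintype.mem_piFinset.2 fun j => add_mem_add (this j) hp.1
  have hfib := card_eq_sum_card_fiberwise (f := fun p : ℤ × (Fin m → ℤ) => fun j => p.2 j + p.1)
    (s := H ×ˢ G) (t := T) hmaps
  obtain ⟨b, -, hb⟩ := exists_le_of_sum_le (s := T) hTne
    (f := fun _ => ((H ×ˢ G).card : ℝ) / T.card)
    (g := fun b => (((H ×ˢ G).filter
      (fun p : ℤ × (Fin m → ℤ) => (fun j => p.2 j + p.1) = b)).card : ℝ)) (by
      have hT0 : (T.card : ℝ) ≠ 0 := by exact_mod_cast hTne.card_ne_zero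
      rw [sum_const, nsmul_eq_mul, mul_div_cancel₀ _ hT0]
      exact_mod_cast hfib.le)
  refine ⟨b, ((H ×ˢ G).filter
      (fun p : ℤ × (Fin m → ℤ) => (fun j => p.2 j + p.1) = b)).image Prod.fst, ?_, ?_, ?_⟩
  · intro z hz
    obtain ⟨p, hp, rfl⟩ := mem_image.1 hz
    exact (mem_product.1 (mem_filter.1 hp).1).1
  · rw [card_image_of_injOn]
    · have hT0 : (0 : ℝ) < T.card := by exact_mod_cast hTne.card_pos
      rw [div_le_iff₀ hT0, card_product, hTc] at hb
      push_cast at hb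
      set F := (((H ×ˢ G).filter
        (fun p : ℤ × (Fin m → ℤ) => (fun j => p.2 j + p.1) = b)).card : ℝ) with hF
      have hF0 : 0 ≤ F := by positivity
      have h4 : ((H + H).card : ℝ) ^ m ≤ K ^ m * H.card ^ m := by
        rw [← mul_pow]; gcongr
      have h5 : (H.card : ℝ) * (H.card ^ m) ≤ (2 * K ^ m * F) * H.card ^ m := by
        calc (H.card : ℝ) * (H.card ^ m) ≤ H.card * (2 * G.card) := by gcongr
          _ = 2 * (H.card * G.card) := by ring
          _ ≤ 2 * (F * (H + H).card ^ m) := by gcongr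
          _ ≤ 2 * (F * (K ^ m * H.card ^ m)) := by gcongr
          _ = _ := by ring
      exact le_of_mul_le_mul_right h5 (by positivity)
    · intro p hp q hq hpq
      have e1 := (mem_filter.1 hp).2
      have e2 := (mem_filter.1 hq).2
      refine Prod.ext hpq (funext fun j => ?_)
      have := congrFun (e1.trans e2.symm) j
      have h6 : p.2 j + p.1 = q.2 j + q.1 := this
      rw [show p.1 = q.1 from hpq] at h6
      linarith
  · intro z hz
    obtain ⟨p, hp, rfl⟩ := mem_image.1 hz
    obtain ⟨hp1, rfl⟩ := mem_filter.1 hp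
    have hpG := mem_filter.1 (mem_product.1 hp1).2
    have := Fintype.mem_piFinset.1 hpG.1
    simpa using ⟨this, hpG.2⟩

/-- A sample with small exponential deviation is close to the density in `ℓ¹` on every set `W`. -/
theorem sum_abs_sub_le_of_expDeviation {m : ℕ} (H S D W : Finset ℤ) {l ε : ℝ} (hl : 0 < l)
    (hε : 0 ≤ ε) (a : Fin m → ℤ)
    (hD : ∀ x ∉ D, sampleDensity S a x = 0 ∧ shiftDensity H S x = 0) :
    ∑ x ∈ W, |sampleDensity S a x - shiftDensity H S x| ≤
      ε * W.card + Real.exp (-l * ε) / l * expDeviation H S D l a := by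
  classical
  have hpt : ∀ u : ℝ, |u| ≤ ε + Real.exp (-l * ε) / l * (Real.exp (l * u) + Real.exp (-l * u)) := by
    intro u
    have h1 : Real.exp (l * |u|) ≤ Real.exp (l * u) + Real.exp (-l * u) := by
      rcases abs_cases u with ⟨h, _⟩ | ⟨h, _⟩ <;> rw [h]
      · linarith [Real.exp_pos (-l * u)]
      · rw [show l * -u = -l * u by ring]; linarith [Real.exp_pos (l * u)]
    have h2 : l * (|u| - ε) ≤ Real.exp (l * (|u| - ε)) := by
      linarith [Real.add_one_le_exp (l * (|u| - ε))]
    have h3 : Real.exp (l * (|u| - ε)) = Real.exp (-l * ε) * Real.exp (l * |u|) := by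
      rw [← Real.exp_add]; congr 1; ring
    have h4 : |u| - ε ≤ Real.exp (-l * ε) * Real.exp (l * |u|) / l := by
      rw [le_div_iff₀ hl, ← h3]; linarith
    have h5 : Real.exp (-l * ε) * Real.exp (l * |u|) / l ≤
        Real.exp (-l * ε) / l * (Real.exp (l * u) + Real.exp (-l * u)) := by
      rw [mul_div_right_comm]; gcongr
    linarith
  set E : ℤ → ℝ := fun x => Real.exp (l * (sampleDensity S a x - shiftDensity H S x)) +
    Real.exp (-l * (sampleDensity S a x - shiftDensity H S x)) with hE
  calc ∑ x ∈ W, |sampleDensity S a x - shiftDensity H S x|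
      = ∑ x ∈ W.filter (· ∈ D), |sampleDensity S a x - shiftDensity H S x| := by
        rw [sum_filter]
        refine sum_congr rfl fun x _ => ?_
        split_ifs with h
        · rfl
        · rw [(hD x h).1, (hD x h).2]; simp
    _ ≤ ∑ x ∈ W.filter (· ∈ D), (ε + Real.exp (-l * ε) / l * E x) :=
        sum_le_sum fun x _ => hpt _
    _ = ε * (W.filter (· ∈ D)).card + Real.exp (-l * ε) / l * ∑ x ∈ W.filter (· ∈ D), E x := by
        rw [sum_add_distrib, sum_const, nsmul_eq_mul, mul_sum, mul_comm ε]
    _ ≤ _ := by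
        have h1 : ((W.filter (· ∈ D)).card : ℝ) ≤ W.card := by
          exact_mod_cast card_filter_le _ _
        have h2 : ∑ x ∈ W.filter (· ∈ D), E x ≤ expDeviation H S D l a :=
          sum_le_sum_of_subset_of_nonneg (fun x hx => (mem_filter.1 hx).2)
            fun x _ _ => by positivity
        gcongr

theorem eq_sum_testBit_two_pow {N s : ℕ} (hN : N < 2 ^ s) :
    N = ∑ i ∈ range s, if N.testBit i then 2 ^ i else 0 := by
  conv_lhs => rw [← sum_toFinset_bitIndices_two_pow N]
  rw [← sum_filter]
  refine sum_congr ?_ fun _ _ => rfl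
  ext i
  simp only [List.mem_toFinset, Nat.mem_bitIndices, mem_filter, mem_range]
  refine ⟨fun h => ⟨?_, h⟩, fun h => h.2⟩
  exact (Nat.pow_lt_pow_iff_right (by norm_num)).1
    ((Nat.two_pow_le_of_mem_bitIndices (Nat.mem_bitIndices.2 h)).trans_lt hN)

/-- **Croot–Sisask almost periodicity**: there is a large `Z ⊆ H` such that sums of `ℓ` elements
of `Z - Z` stay in `2H - 2H`. -/
theorem exists_almost_periods {H : Finset ℤ} (hH : H.Nonempty) {K κ : ℝ} (hK : 2 ≤ K)
    (hκ : 1 ≤ κ) (hKκ : K ≤ Real.exp κ)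
    (hd : ((H + H).card : ℝ) ≤ K * H.card) {ℓ m : ℕ} (hℓ : 1 ≤ ℓ)
    (hm : 48 ^ 2 * (ℓ : ℝ) ^ 2 * κ ≤ m) :
    ∃ Z ⊆ H, (H.card : ℝ) ≤ 2 * K ^ m * Z.card ∧
      ∀ z z' : ℕ → ℤ, (∀ j, z j ∈ Z) → (∀ j, z' j ∈ Z) →
        ∑ j ∈ range ℓ, (z j - z' j) ∈ 2 • H - 2 • H := by
  classical
  have hpos : (0 : ℝ) < H.card := by exact_mod_cast hH.card_pos
  have hℓ' : (1 : ℝ) ≤ ℓ := by exact_mod_cast hℓ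
  set l : ℝ := 48 * ℓ * κ with hl
  have hl0 : 48 * (ℓ : ℝ) ≤ l := by rw [hl]; nlinarith
  have hlpos : 0 < l := by linarith
  have hlm : l ≤ m := by
    refine le_trans ?_ hm
    rw [hl]
    nlinarith [mul_le_mul_of_nonneg_right hℓ' (by positivity : 0 ≤ (ℓ : ℝ) * κ)]
  have hm0 : (0 : ℝ) < m := by linarith
  have hm0' : 0 < m := by exact_mod_cast hm0
  set S := H + H with hS
  set D := 2 • H - 1 • H with hD
  obtain ⟨b, Z, hZH, hZc, hZ⟩ := exists_shifts_of_good_samples hH hd S D hm0'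
    (l := l) (by rw [abs_of_pos hlpos]; exact hlm)
  refine ⟨Z, hZH, hZc, ?_⟩
  have hDc : (D.card : ℝ) ≤ K ^ 3 * H.card := card_nsmul_sub_nsmul_le hH hd 2 1
  have hDf : ∀ x ∉ D, ∀ h ∈ H, x + h ∉ S := by
    intro x hx h hh hxS
    refine hx ?_
    rw [hD, one_nsmul, two_nsmul]
    exact mem_sub.2 ⟨x + h, hxS, h, hh, by ring⟩
  have hf0 : ∀ x ∉ D, shiftDensity H S x = 0 := by
    intro x hx
    rw [shiftDensity, sum_eq_zero, zero_div]
    intro h hh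
    rw [if_neg (hDf x hx h hh)]
  set δ : ℝ := (1 / (8 * ℓ) + 1 / (48 * ℓ)) * H.card with hδ
  have hbound : Real.exp (-l * (1 / (8 * ℓ))) / l * (4 * D.card * Real.exp (l ^ 2 / m)) ≤
      1 / (48 * ℓ) * H.card := by
    have h1 : l ^ 2 / m ≤ κ := by
      rw [div_le_iff₀ hm0]
      calc l ^ 2 = κ * (48 ^ 2 * (ℓ : ℝ) ^ 2 * κ) := by rw [hl]; ring
        _ ≤ κ * m := by gcongr
    have h2 : -l * (1 / (8 * ℓ)) = -(6 * κ) := by rw [hl]; field_simp; ring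
    have h3 : 4 * K ^ 3 ≤ Real.exp (5 * κ) := by
      calc 4 * K ^ 3 ≤ K ^ 2 * K ^ 3 := by
            gcongr; nlinarith
        _ = K ^ 5 := by ring
        _ ≤ (Real.exp κ) ^ 5 := by gcongr
        _ = _ := by rw [← Real.exp_nat_mul]; norm_num
    rw [h2]
    calc Real.exp (-(6 * κ)) / l * (4 * D.card * Real.exp (l ^ 2 / m))
        ≤ Real.exp (-(6 * κ)) / (48 * ℓ) * (4 * (K ^ 3 * H.card) * Real.exp κ) := by gcongr
      _ = Real.exp (-(6 * κ)) / (48 * ℓ) * ((4 * K ^ 3) * H.card * Real.exp κ) := by ring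
      _ ≤ Real.exp (-(6 * κ)) / (48 * ℓ) * (Real.exp (5 * κ) * H.card * Real.exp κ) := by gcongr
      _ = (Real.exp (-(6 * κ)) * Real.exp (5 * κ) * Real.exp κ) / (48 * ℓ) * H.card := by ring
      _ = _ := by
        rw [← Real.exp_add, ← Real.exp_add, show -(6 * κ) + 5 * κ + κ = 0 by ring, Real.exp_zero]
  have hone : ∀ z ∈ Z, ∀ W : Finset ℤ, W.card ≤ H.card →
      ∑ x ∈ W, |sampleDensity S b x - shiftDensity H S (x + z)| ≤ δ := by
    intro z hz W hW
    obtain ⟨hzH, hzE⟩ := hZ z hz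
    have h1 := sum_abs_sub_le_of_expDeviation H S D (W.image (· + z)) hlpos
      (ε := 1 / (8 * ℓ)) (by positivity) (fun j => b j - z) (fun x hx => ⟨by
        rw [sampleDensity, sum_eq_zero, zero_div]
        intro j _
        rw [if_neg (hDf x hx _ (hzH j))], hf0 x hx⟩)
    rw [sum_image (fun x _ y _ h => by simpa using h)] at h1
    have h2 : ∀ x, sampleDensity S (fun j => b j - z) (x + z) = sampleDensity S b x := by
      intro x
      unfold sampleDensity
      simp only [add_add_sub_cancel]
    simp only [h2] at h1
    refine h1.trans ?_
    have h3 : ((W.image (· + z)).card : ℝ) ≤ H.card := by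
      exact_mod_cast card_image_le.trans hW
    rw [hδ, add_mul]
    refine add_le_add (by gcongr) (le_trans ?_ hbound)
    gcongr
  have htwo : ∀ z ∈ Z, ∀ z' ∈ Z, ∀ W : Finset ℤ, W.card ≤ H.card →
      ∑ x ∈ W, |shiftDensity H S (x + (z - z')) - shiftDensity H S x| ≤ 2 * δ := by
    intro z hz z' hz' W hW
    have hc : (W.image (· - z')).card ≤ H.card := card_image_le.trans hW
    have h1 := hone z hz _ hc
    have h2 := hone z' hz' _ hc
    rw [sum_image (fun x _ y _ h => by simpa using h)] at h1 h2
    have h3 : ∀ x ∈ W, |shiftDensity H S (x + (z - z')) - shiftDensity H S x| ≤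
        |sampleDensity S b (x - z') - shiftDensity H S (x - z' + z)| +
        |sampleDensity S b (x - z') - shiftDensity H S (x - z' + z')| := by
      intro x _
      rw [show x - z' + z = x + (z - z') by ring, sub_add_cancel]
      rw [abs_sub_comm (sampleDensity S b (x - z')) (shiftDensity H S (x + (z - z')))]
      exact abs_sub_le _ _ _
    refine (sum_le_sum h3).trans ?_
    rw [sum_add_distrib]
    linarith
  intro z z' hz hz'
  have hpath : ∀ n : ℕ, ∑ x ∈ H, |shiftDensity H S (x + ∑ j ∈ range n, (z j - z' j)) -
      shiftDensity H S x| ≤ n * (2 * δ) := by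
    intro n
    induction n with
    | zero => simp
    | succ n ih =>
      have h1 := htwo _ (hz n) _ (hz' n) (H.image (· + ∑ j ∈ range n, (z j - z' j))) card_image_le
      rw [sum_image (fun x _ y _ h => by simpa using h)] at h1
      have h2 : ∀ x ∈ H, |shiftDensity H S (x + ∑ j ∈ range (n + 1), (z j - z' j)) -
          shiftDensity H S x| ≤
          |shiftDensity H S (x + ∑ j ∈ range n, (z j - z' j) + (z n - z' n)) -
            shiftDensity H S (x + ∑ j ∈ range n, (z j - z' j))| +
          |shiftDensity H S (x + ∑ j ∈ range n, (z j - z' j)) - shiftDensity H S x| := by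
        intro x _
        rw [sum_range_succ, ← add_assoc]
        exact abs_sub_le _ _ _
      refine (sum_le_sum h2).trans ?_
      rw [sum_add_distrib]
      push_cast
      linarith
  set p := ∑ j ∈ range ℓ, (z j - z' j) with hp
  by_contra hcon
  have hlast := hpath ℓ
  rw [← hp] at hlast
  have hval : ∀ x ∈ H, |shiftDensity H S (x + p) - shiftDensity H S x| = 1 := by
    intro x hx
    have h1 : shiftDensity H S x = 1 := by
      rw [shiftDensity, sum_congr rfl (g := fun _ => (1 : ℝ))
        (fun h hh => if_pos (add_mem_add hx hh)), sum_const, nsmul_eq_mul, mul_one,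
        div_self hpos.ne']
    have h2 : shiftDensity H S (x + p) = 0 := by
      rw [shiftDensity, sum_eq_zero, zero_div]
      intro h hh
      refine if_neg fun hmem => hcon ?_
      rw [two_nsmul]
      exact mem_sub.2 ⟨x + p + h, hmem, x + h, add_mem_add hx hh, by ring⟩
    rw [h1, h2]; norm_num
  rw [sum_congr rfl hval, sum_const, nsmul_eq_mul, mul_one] at hlast
  have : (ℓ : ℝ) * (2 * δ) = (7 / 24) * H.card := by rw [hδ]; field_simp; norm_num
  rw [this] at hlast
  linarith

/-- Passing to a large `Y ⊆ H` whose differences stay in `2H - 2H` after multiplication by any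
`N < 2 ^ s`. -/
theorem exists_dilatable_subset {H : Finset ℤ} (hH : H.Nonempty) {K κ : ℝ} (hK : 2 ≤ K)
    (hκ : 1 ≤ κ) (hKκ : K ≤ Real.exp κ)
    (hd : ((H + H).card : ℝ) ≤ K * H.card) {s m : ℕ} (hs : 1 ≤ s)
    (hm : 48 ^ 2 * (s : ℝ) ^ 2 * κ ≤ m) :
    ∃ Y ⊆ H, (H.card : ℝ) ≤ (2 * K ^ m) ^ s * (K ^ (3 * s + 1)) ^ s * Y.card ∧
      ∀ y ∈ Y, ∀ y' ∈ Y, ∀ N : ℕ, N < 2 ^ s → (N : ℤ) * (y - y') ∈ 2 • H - 2 • H := by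
  classical
  have hpos : (0 : ℝ) < H.card := by exact_mod_cast hH.card_pos
  have hK0 : 0 < K := by linarith
  obtain ⟨Z, hZH, hZc, hZ⟩ := exists_almost_periods hH hK hκ hKκ hd hs hm
  have hZpos : (0 : ℝ) < Z.card := by
    by_contra h
    have : (Z.card : ℝ) = 0 := le_antisymm (not_lt.1 h) (by positivity)
    rw [this, mul_zero] at hZc
    linarith
  have hZne : Z.Nonempty := card_pos.1 (by exact_mod_cast hZpos)
  obtain ⟨z₀, hz₀⟩ := hZne
  set B : Fin s → Finset ℤ := fun i => H.image (fun x => 2 ^ (i : ℕ) * x) + H with hB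
  set P := Fintype.piFinset (fun _ : Fin s => Z) with hP
  set T := Fintype.piFinset B with hT
  set φ : ℤ × (Fin s → ℤ) → (Fin s → ℤ) := fun p i => 2 ^ (i : ℕ) * p.1 + p.2 i with hφ
  have hPc : (P.card : ℝ) = Z.card ^ s := by rw [hP, Fintype.card_piFinset]; simp
  have hTc : (T.card : ℝ) ≤ (K ^ (3 * s + 1) * H.card) ^ s := by
    rw [hT, Fintype.card_piFinset]
    push_cast
    calc ∏ i, ((B i).card : ℝ) ≤ ∏ _i : Fin s, (K ^ (3 * s + 1) * H.card) := by
          refine prod_le_prod (fun _ _ => by positivity) fun i _ => ?_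
          refine (card_two_pow_dilate_add_le hH hK0.le hd i).trans ?_
          have : (1 : ℝ) ≤ K := by linarith
          gcongr
          · exact i.2.le
      _ = _ := by simp
  have hTne : T.Nonempty := Fintype.piFinset_nonempty.2 fun _ => (hH.image _).add hH
  have hmaps : ∀ p ∈ H ×ˢ P, φ p ∈ T := by
    intro p hp
    rw [mem_product] at hp
    have := Fintype.mem_piFinset.1 hp.2
    exact Fintype.mem_piFinset.2 fun j =>
      add_mem_add (mem_image_of_mem _ hp.1) (hZH (this j))
  have hfib := card_eq_sum_card_fiberwise (f := φ) (s := H ×ˢ P) (t := T) hmaps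
  obtain ⟨b, -, hb⟩ := exists_le_of_sum_le (s := T) hTne
    (f := fun _ => ((H ×ˢ P).card : ℝ) / T.card)
    (g := fun b => (((H ×ˢ P).filter (fun p => φ p = b)).card : ℝ)) (by
      have hT0 : (T.card : ℝ) ≠ 0 := by exact_mod_cast hTne.card_ne_zero
      rw [sum_const, nsmul_eq_mul, mul_div_cancel₀ _ hT0]
      exact_mod_cast hfib.le)
  refine ⟨((H ×ˢ P).filter (fun p => φ p = b)).image Prod.fst, ?_, ?_, ?_⟩
  · intro z hz
    obtain ⟨p, hp, rfl⟩ := mem_image.1 hz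
    exact (mem_product.1 (mem_filter.1 hp).1).1
  · rw [card_image_of_injOn]
    · have hT0 : (0 : ℝ) < T.card := by exact_mod_cast hTne.card_pos
      rw [div_le_iff₀ hT0, card_product] at hb
      push_cast at hb
      rw [hPc] at hb
      set F := (((H ×ˢ P).filter (fun p => φ p = b)).card : ℝ) with hF
      have hF0 : 0 ≤ F := by positivity
      have h5 : (H.card : ℝ) * (H.card ^ s) ≤
          ((2 * K ^ m) ^ s * (K ^ (3 * s + 1)) ^ s * F) * H.card ^ s := by
        calc (H.card : ℝ) * (H.card ^ s) ≤ H.card * (2 * K ^ m * Z.card) ^ s := by gcongr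
          _ = (2 * K ^ m) ^ s * (H.card * Z.card ^ s) := by ring
          _ ≤ (2 * K ^ m) ^ s * (F * T.card) := by gcongr
          _ ≤ (2 * K ^ m) ^ s * (F * (K ^ (3 * s + 1) * H.card) ^ s) := by gcongr
          _ = _ := by ring
      exact le_of_mul_le_mul_right h5 (by positivity)
    · intro p hp q hq hpq
      have e1 := (mem_filter.1 hp).2
      have e2 := (mem_filter.1 hq).2
      refine Prod.ext hpq (funext fun j => ?_)
      have h6 : 2 ^ (j : ℕ) * p.1 + p.2 j = 2 ^ (j : ℕ) * q.1 + q.2 j :=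
        congrFun (e1.trans e2.symm) j
      rw [show p.1 = q.1 from hpq] at h6
      linarith
  · intro y hy y' hy' N hN
    obtain ⟨p, hp, rfl⟩ := mem_image.1 hy
    obtain ⟨q, hq, rfl⟩ := mem_image.1 hy'
    have e1 := (mem_filter.1 hp).2
    have e2 := (mem_filter.1 hq).2
    have hpP := Fintype.mem_piFinset.1 (mem_product.1 (mem_filter.1 hp).1).2
    have hqP := Fintype.mem_piFinset.1 (mem_product.1 (mem_filter.1 hq).1).2
    have hdig : ∀ i (hi : i < s), 2 ^ i * (p.1 - q.1) = q.2 ⟨i, hi⟩ - p.2 ⟨i, hi⟩ := by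
      intro i hi
      have h6 : 2 ^ i * p.1 + p.2 ⟨i, hi⟩ = 2 ^ i * q.1 + q.2 ⟨i, hi⟩ :=
        congrFun (e1.trans e2.symm) ⟨i, hi⟩
      linarith
    set z : ℕ → ℤ := fun i => if h : i < s then (if N.testBit i then q.2 ⟨i, h⟩ else z₀) else z₀
      with hzdef
    set z' : ℕ → ℤ := fun i => if h : i < s then (if N.testBit i then p.2 ⟨i, h⟩ else z₀) else z₀
      with hzdef'
    have hmem := hZ z z' (by
      intro j; simp only [hzdef]; split_ifs <;> first | exact hqP _ | exact hz₀) (by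
      intro j; simp only [hzdef']; split_ifs <;> first | exact hpP _ | exact hz₀)
    have hN' : (N : ℤ) = ∑ i ∈ range s, if N.testBit i then (2 : ℤ) ^ i else 0 := by
      exact_mod_cast (eq_sum_testBit_two_pow hN)
    rw [hN', sum_mul]
    convert hmem using 1
    refine sum_congr rfl fun i hi => ?_
    have hi' := mem_range.1 hi
    simp only [hzdef, hzdef', dif_pos hi']
    split_ifs with h
    · exact hdig i hi'
    · simp

theorem mul_logb_add_mul_logb_add_min_le {a b : ℝ} (ha : 1 ≤ a) (hb : 1 ≤ b) :
    a * Real.logb 2 a + b * Real.logb 2 b + min a b ≤ (a + b) * Real.logb 2 (a + b) := by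
  wlog hab : a ≤ b generalizing a b
  · have := this hb ha (le_of_not_ge hab)
    rw [min_comm, add_comm a b]
    linarith
  rw [min_eq_left hab]
  have h1 : 1 + Real.logb 2 a ≤ Real.logb 2 (a + b) := by
    have : Real.logb 2 (2 * a) = 1 + Real.logb 2 a := by
      rw [Real.logb_mul (by norm_num) (by linarith), Real.logb_self_eq_one (by norm_num)]
    rw [← this]
    exact Real.logb_le_logb_of_le (by norm_num) (by linarith) (by linarith)
  have h2 : Real.logb 2 b ≤ Real.logb 2 (a + b) :=
    Real.logb_le_logb_of_le (by norm_num) (by linarith) (by linarith)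
  nlinarith

/-- **Edge-isoperimetry** in the multiplicative grid: a finite set of nonzero rationals spans at
most `n log₂ n` edges `x — t x` with `t` ranging over primes. -/
theorem card_prime_edges_le (T : Finset ℕ) (hT : ∀ t ∈ T, t.Prime) (V : Finset ℚ)
    (hV : (0 : ℚ) ∉ V) :
    (((V ×ˢ T).filter (fun p => (p.2 : ℚ) * p.1 ∈ V)).card : ℝ) ≤
      V.card * Real.logb 2 V.card := by
  classical
  induction hn : V.card using Nat.strong_induction_on generalizing V with
  | _ n ih =>
    subst hn
    set E : Finset ℚ → Finset (ℚ × ℕ) := fun V => (V ×ˢ T).filter (fun p => (p.2 : ℚ) * p.1 ∈ V)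
      with hE
    change ((E V).card : ℝ) ≤ _
    have hmemE : ∀ (W : Finset ℚ) (p : ℚ × ℕ), p ∈ E W ↔
        (p.1 ∈ W ∧ p.2 ∈ T) ∧ (p.2 : ℚ) * p.1 ∈ W := by
      intro W p; simp [hE]
    rcases (E V).eq_empty_or_nonempty with h0 | ⟨⟨q, t⟩, hqt⟩
    · rw [h0]
      rcases V.eq_empty_or_nonempty with rfl | hne
      · simp
      · have : (1 : ℝ) ≤ V.card := by exact_mod_cast hne.card_pos
        have := Real.logb_nonneg (b := 2) (by norm_num) this
        simp only [card_empty, Nat.cast_zero]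
        positivity
    rw [hmemE] at hqt
    obtain ⟨⟨hq, ht⟩, htq⟩ := hqt
    simp only at hq ht htq
    have hne0 : ∀ x ∈ V, x ≠ 0 := fun x hx h => hV (h ▸ hx)
    have : Fact t.Prime := ⟨hT t ht⟩
    have hval : ∀ x ∈ V, padicValRat t (t * x) = 1 + padicValRat t x := by
      intro x hx
      rw [padicValRat.mul (by exact_mod_cast (hT t ht).ne_zero) (hne0 x hx),
        padicValRat.self (hT t ht).one_lt]
    have hval' : ∀ r ∈ T, r ≠ t → ∀ x ∈ V, padicValRat t (r * x) = padicValRat t x := by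
      intro r hr hrt x hx
      have : Fact r.Prime := ⟨hT r hr⟩
      rw [padicValRat.mul (by exact_mod_cast (hT r hr).ne_zero) (hne0 x hx), padicValRat.of_nat,
        padicValNat_primes (Ne.symm hrt)]
      simp
    set e := padicValRat t q with he
    set V₁ := V.filter (fun x => padicValRat t x ≤ e) with hV₁
    set V₂ := V.filter (fun x => ¬ padicValRat t x ≤ e) with hV₂
    have hsum : V₁.card + V₂.card = V.card := card_filter_add_card_filter_not _
    have hq₁ : q ∈ V₁ := mem_filter.2 ⟨hq, le_rfl⟩
    have hq₂ : (t : ℚ) * q ∈ V₂ := mem_filter.2 ⟨htq, by rw [hval q hq]; omega⟩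
    have hc₁ : 0 < V₁.card := card_pos.2 ⟨_, hq₁⟩
    have hc₂ : 0 < V₂.card := card_pos.2 ⟨_, hq₂⟩
    have ih₁ := ih V₁.card (by omega) V₁ (fun h => hV (mem_filter.1 h).1) rfl
    have ih₂ := ih V₂.card (by omega) V₂ (fun h => hV (mem_filter.1 h).1) rfl
    change ((E V₁).card : ℝ) ≤ _ at ih₁
    change ((E V₂).card : ℝ) ≤ _ at ih₂
    set X := (E V).filter (fun p => p.1 ∈ V₁ ∧ (p.2 : ℚ) * p.1 ∈ V₂) with hX
    have hXt : ∀ p ∈ X, p.2 = t := by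
      intro p hp
      obtain ⟨hpE, hp₁, hp₂⟩ := mem_filter.1 hp
      by_contra hne
      rw [hmemE] at hpE
      have h1 := (mem_filter.1 hp₁).2
      have h2 := (mem_filter.1 hp₂).2
      rw [hval' _ hpE.1.2 hne _ hpE.1.1] at h2
      exact h2 h1
    have hX₁ : X.card ≤ V₁.card :=
      card_le_card_of_injOn Prod.fst (fun p hp => (mem_filter.1 hp).2.1)
        fun p hp r hr h => Prod.ext h ((hXt p hp).trans (hXt r hr).symm)
    have hX₂ : X.card ≤ V₂.card :=
      card_le_card_of_injOn (fun p => (p.2 : ℚ) * p.1) (fun p hp => (mem_filter.1 hp).2.2)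
        fun p hp r hr h => by
          simp only [hXt p hp, hXt r hr] at h
          have htne : (t : ℚ) ≠ 0 := by exact_mod_cast (hT t ht).ne_zero
          exact Prod.ext (mul_left_cancel₀ htne h) ((hXt p hp).trans (hXt r hr).symm)
    have hsub : E V ⊆ E V₁ ∪ E V₂ ∪ X := by
      intro p hp
      have hp' := (hmemE V p).1 hp
      have hcase : ∀ x ∈ V, x ∈ V₁ ∨ x ∈ V₂ := by
        intro x hx
        rw [hV₁, hV₂, mem_filter, mem_filter]
        tauto
      rw [mem_union, mem_union, hmemE, hmemE]
      rcases hcase _ hp'.1.1 with h1 | h1 <;> rcases hcase _ hp'.2 with h2 | h2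
      · exact Or.inl (Or.inl ⟨⟨h1, hp'.1.2⟩, h2⟩)
      · exact Or.inr (mem_filter.2 ⟨hp, h1, h2⟩)
      · exfalso
        have h3 := (mem_filter.1 h1).2
        have h4 := (mem_filter.1 h2).2
        by_cases hpt : p.2 = t
        · rw [hpt, hval _ hp'.1.1] at h4; omega
        · rw [hval' _ hp'.1.2 hpt _ hp'.1.1] at h4; exact h3 h4
      · exact Or.inl (Or.inr ⟨⟨h1, hp'.1.2⟩, h2⟩)
    have hcard : (E V).card ≤ (E V₁).card + (E V₂).card + X.card :=
      (card_le_card hsub).trans ((card_union_le _ _).trans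
        (Nat.add_le_add_right (card_union_le _ _) _))
    have hcard' : ((E V).card : ℝ) ≤ (E V₁).card + (E V₂).card + X.card := by exact_mod_cast hcard
    have hXmin : (X.card : ℝ) ≤ min (V₁.card : ℝ) V₂.card :=
      le_min (by exact_mod_cast hX₁) (by exact_mod_cast hX₂)
    have hfin := mul_logb_add_mul_logb_add_min_le (a := V₁.card) (b := V₂.card)
      (by exact_mod_cast hc₁) (by exact_mod_cast hc₂)
    have hsum' : (V₁.card : ℝ) + V₂.card = V.card := by exact_mod_cast hsum
    rw [hsum'] at hfin
    linarith

/-- For at least half of the pairs `(x, t)` the quotient `x / t` has few prime multiples in `R`. -/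
theorem card_low_degree_pairs {R : Finset ℚ} (hR : (0 : ℚ) ∉ R) {T : Finset ℕ}
    (hT : ∀ t ∈ T, t.Prime) {L : ℕ} (hL : 1 ≤ L) (hRT : 2 * (R.card * T.card) ≤ 2 ^ L)
    (hTL : 4 * L ≤ T.card) :
    R.card * T.card ≤ 2 * ((R ×ˢ T).filter (fun p : ℚ × ℕ =>
      (T.filter (fun r : ℕ => (r : ℚ) * (p.1 / p.2) ∈ R)).card ≤ 4 * L)).card := by
  classical
  set deg : ℚ → ℕ := fun q => (T.filter (fun r : ℕ => (r : ℚ) * q ∈ R)).card with hdeg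
  change _ ≤ 2 * ((R ×ˢ T).filter (fun p : ℚ × ℕ => deg (p.1 / p.2) ≤ 4 * L)).card
  set B := (R ×ˢ T).filter (fun p : ℚ × ℕ => ¬ deg (p.1 / p.2) ≤ 4 * L) with hB
  have hsplit : ((R ×ˢ T).filter (fun p : ℚ × ℕ => deg (p.1 / p.2) ≤ 4 * L)).card + B.card =
      R.card * T.card := by rw [← card_product]; exact card_filter_add_card_filter_not _
  set Q := B.image (fun p : ℚ × ℕ => p.1 / (p.2 : ℚ)) with hQ
  have htne : ∀ t ∈ T, (t : ℚ) ≠ 0 := fun t ht => by exact_mod_cast (hT t ht).ne_zero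
  have hQdeg : 4 * L * Q.card ≤ R.card * T.card := by
    have h1 : ∑ q ∈ Q, deg q ≤ (R ×ˢ T).card := by
      rw [← card_sigma Q (fun q => T.filter (fun r : ℕ => (r : ℚ) * q ∈ R))]
      refine card_le_card_of_injOn (fun p => ((p.2 : ℚ) * p.1, p.2)) ?_ ?_
      · intro p hp
        have := (mem_sigma.1 hp).2
        rw [mem_filter] at this
        exact mem_product.2 ⟨this.2, this.1⟩
      · rintro ⟨q, r⟩ hp ⟨q', r'⟩ hp' h
        have h2 := (mem_filter.1 (mem_sigma.1 hp).2).1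
        simp only [Prod.mk.injEq] at h
        obtain ⟨h3, rfl⟩ := h
        rw [mul_left_cancel₀ (htne _ h2) h3]
    rw [card_product] at h1
    refine le_trans ?_ h1
    rw [mul_comm, ← smul_eq_mul]
    refine card_nsmul_le_sum _ _ _ fun q hq => ?_
    obtain ⟨p, hp, rfl⟩ := mem_image.1 hq
    exact (not_le.1 (mem_filter.1 hp).2).le
  set V := R ∪ Q with hVdef
  have hV0 : (0 : ℚ) ∉ V := by
    rw [hVdef, mem_union, not_or]
    refine ⟨hR, fun h => ?_⟩
    obtain ⟨p, hp, h⟩ := mem_image.1 h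
    have hp' := mem_product.1 (mem_filter.1 hp).1
    rcases div_eq_zero_iff.1 h with h | h
    · exact hR (h ▸ hp'.1)
    · exact htne _ hp'.2 h
  have hBE : B.card ≤ ((V ×ˢ T).filter (fun p => (p.2 : ℚ) * p.1 ∈ V)).card := by
    refine card_le_card_of_injOn (fun p => (p.1 / (p.2 : ℚ), p.2)) ?_ ?_
    · intro p hp
      have hp' := mem_product.1 (mem_filter.1 hp).1
      refine mem_filter.2 ⟨mem_product.2 ⟨mem_union_right _ (mem_image_of_mem _ hp), hp'.2⟩, ?_⟩
      simp only
      rw [mul_div_cancel₀ _ (htne _ hp'.2)]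
      exact mem_union_left _ hp'.1
    · rintro ⟨x, t⟩ hp ⟨x', t'⟩ hp' h
      simp only [Prod.mk.injEq] at h
      obtain ⟨h3, rfl⟩ := h
      have := htne t (mem_product.1 (mem_filter.1 hp).1).2
      rw [div_left_inj' this] at h3
      rw [h3]
  have hBQ : Q.card ≤ R.card * T.card := by
    rw [← card_product]; exact card_image_le.trans (card_filter_le _ _)
  have hVc : V.card ≤ R.card + Q.card := card_union_le _ _
  have hlog : (V.card : ℝ) * Real.logb 2 V.card ≤ V.card * L := by
    rcases Nat.eq_zero_or_pos V.card with h0 | h0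
    · rw [h0]; simp
    refine mul_le_mul_of_nonneg_left ?_ (Nat.cast_nonneg _)
    have h1 : V.card ≤ 2 ^ L := by
      have : R.card ≤ R.card * T.card := Nat.le_mul_of_pos_right _ (by omega)
      omega
    rw [Real.logb_le_iff_le_rpow (by norm_num) (by exact_mod_cast h0), Real.rpow_natCast]
    exact_mod_cast h1
  have hfin : B.card ≤ V.card * L := by
    have := (card_prime_edges_le T hT V hV0).trans hlog
    exact hBE.trans (by exact_mod_cast this)
  have h5 : 4 * B.card ≤ 2 * (R.card * T.card) := by
    calc 4 * B.card ≤ 4 * ((R.card + Q.card) * L) := by gcongr; exact hfin.trans (by gcongr)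
      _ = R.card * (4 * L) + 4 * L * Q.card := by ring
      _ ≤ R.card * T.card + R.card * T.card := by gcongr
      _ = _ := by ring
  omega

/-- Cauchy–Schwarz: a map with small image has many collisions. -/
theorem sq_card_le_card_mul_card_collisions {α β : Type*} [DecidableEq α] [DecidableEq β]
    (s : Finset α) (t : Finset β) (f : α → β) (h : ∀ a ∈ s, f a ∈ t) :
    s.card ^ 2 ≤ t.card * ((s ×ˢ s).filter (fun p => f p.1 = f p.2)).card := by
  have h1 : ((s ×ˢ s).filter (fun p => f p.1 = f p.2)).card =
      ∑ b ∈ t, (s.filter (fun a => f a = b)).card ^ 2 := by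
    rw [card_eq_sum_card_fiberwise (f := fun p : α × α => f p.1) (t := t)
      (fun p hp => h _ (mem_product.1 (mem_filter.1 hp).1).1)]
    refine sum_congr rfl fun b _ => ?_
    rw [sq, ← card_product]
    congr 1
    ext p
    simp only [mem_filter, mem_product]
    constructor
    · rintro ⟨⟨⟨h1, h2⟩, h3⟩, h4⟩
      exact ⟨⟨h1, h4⟩, h2, h3 ▸ h4⟩
    · rintro ⟨⟨h1, h4⟩, h2, h3⟩
      exact ⟨⟨⟨h1, h2⟩, h4.trans h3.symm⟩, h4⟩
  rw [h1, card_eq_sum_card_fiberwise h]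
  exact sq_sum_le_card_mul_sum_sq

/-- For fixed `n ≠ 0` the equations `a - b = t ^ k * n` have few solutions with `a, b` of low
degree over `t`, by the uniform bound on the rational points of `y ^ k = x ^ k + n`. -/
theorem card_low_degree_solutions_le {k C : ℕ} (hU : Uk k C) {A : Finset ℤ}
    {ρ : ℤ → ℤ} (hρ : ∀ a ∈ A, ρ a ^ k = a) {T : Finset ℕ} (hT : ∀ t ∈ T, t.Prime) (D : ℕ)
    {n : ℤ} (hn : n ≠ 0) :
    ((T ×ˢ (A ×ˢ A)).filter (fun p : ℕ × (ℤ × ℤ) =>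
      (T.filter (fun r : ℕ => (r : ℚ) * ((ρ p.2.1 : ℚ) / p.1) ∈
        A.image (fun a => (ρ a : ℚ)))).card ≤ D ∧
      p.2.1 - p.2.2 = (p.1 : ℤ) ^ k * n)).card ≤ D * C := by
  classical
  set X := (T ×ˢ (A ×ˢ A)).filter (fun p : ℕ × (ℤ × ℤ) =>
      (T.filter (fun r : ℕ => (r : ℚ) * ((ρ p.2.1 : ℚ) / p.1) ∈
        A.image (fun a => (ρ a : ℚ)))).card ≤ D ∧
      p.2.1 - p.2.2 = (p.1 : ℤ) ^ k * n) with hX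
  have htne : ∀ t ∈ T, (t : ℚ) ≠ 0 := fun t ht => by exact_mod_cast (hT t ht).ne_zero
  have hmem : ∀ p ∈ X, p.1 ∈ T ∧ p.2.1 ∈ A ∧ p.2.2 ∈ A := by
    intro p hp
    have := (mem_filter.1 hp).1
    rw [mem_product, mem_product] at this
    exact this
  set φ : ℕ × (ℤ × ℤ) → ℚ × ℚ := fun p => ((ρ p.2.2 : ℚ) / p.1, (ρ p.2.1 : ℚ) / p.1) with hφ
  obtain ⟨hfin, hcard⟩ := hU n hn
  have himg : (X.image φ).card ≤ C := by
    refine le_trans ?_ hcard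
    rw [← Set.ncard_coe_finset]
    refine Set.ncard_le_ncard ?_ hfin
    intro P hP
    obtain ⟨p, hp, rfl⟩ := mem_image.1 (mem_coe.1 hP)
    obtain ⟨ht, ha, ha'⟩ := hmem p hp
    have heq := (mem_filter.1 hp).2.2
    have h1 : ((ρ p.2.1 : ℚ)) ^ k = p.2.1 := by exact_mod_cast hρ _ ha
    have h2 : ((ρ p.2.2 : ℚ)) ^ k = p.2.2 := by exact_mod_cast hρ _ ha'
    have h3 : (p.2.1 : ℚ) - p.2.2 = (p.1 : ℚ) ^ k * n := by exact_mod_cast heq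
    change ((ρ p.2.1 : ℚ) / p.1) ^ k = ((ρ p.2.2 : ℚ) / p.1) ^ k + n
    rw [div_pow, div_pow, h1, h2]
    have := pow_ne_zero k (htne _ ht)
    field_simp
    linarith
  refine (card_le_mul_card_image (f := φ) X D ?_).trans (Nat.mul_le_mul_left _ himg)
  intro P hP
  obtain ⟨p, hp, rfl⟩ := mem_image.1 hP
  refine le_trans ?_ (mem_filter.1 hp).2.1
  refine card_le_card_of_injOn Prod.fst ?_ ?_
  · intro q hq
    obtain ⟨hqX, hqp⟩ := mem_filter.1 hq
    obtain ⟨ht, ha, ha'⟩ := hmem q hqX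
    refine mem_filter.2 ⟨ht, ?_⟩
    have : (ρ q.2.1 : ℚ) / q.1 = (ρ p.2.1 : ℚ) / p.1 := congrArg Prod.snd hqp
    rw [← this, mul_div_cancel₀ _ (htne _ ht)]
    exact mem_image_of_mem _ ha
  · intro q hq r hr hqr
    obtain ⟨hqX, hqp⟩ := mem_filter.1 hq
    obtain ⟨hrX, hrp⟩ := mem_filter.1 hr
    obtain ⟨ht, ha, ha'⟩ := hmem q hqX
    obtain ⟨-, hb, hb'⟩ := hmem r hrX
    have hφe := hqp.trans hrp.symm
    have e1 : (ρ q.2.2 : ℚ) / q.1 = (ρ r.2.2 : ℚ) / r.1 := congrArg Prod.fst hφe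
    have e2 : (ρ q.2.1 : ℚ) / q.1 = (ρ r.2.1 : ℚ) / r.1 := congrArg Prod.snd hφe
    have hqr' : q.1 = r.1 := hqr
    rw [← hqr', div_left_inj' (htne _ ht)] at e1 e2
    have e1' : ρ q.2.2 = ρ r.2.2 := by exact_mod_cast e1
    have e2' : ρ q.2.1 = ρ r.2.1 := by exact_mod_cast e2
    refine Prod.ext hqr (Prod.ext ?_ ?_)
    · rw [← hρ _ ha, ← hρ _ hb, e2']
    · rw [← hρ _ ha', ← hρ _ hb', e1']

/-- Double counting of `a + t ^ k * y ∈ 3H - 2H` over `a ∈ A`, `y ∈ Y` and primes `t ∈ T`. -/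
theorem sq_card_kth_powers_mul_le {k C : ℕ} (hk : 0 < k) (hU : Uk k C) {A H Y : Finset ℤ}
    {ρ : ℤ → ℤ} (hρ : ∀ a ∈ A, ρ a ^ k = a) (hA0 : (0 : ℤ) ∉ A) (hAH : A ⊆ H)
    {T : Finset ℕ} (hT : ∀ t ∈ T, t.Prime) (hYne : Y.Nonempty)
    (hY : ∀ t ∈ T, ∀ y ∈ Y, ∀ y' ∈ Y, (t : ℤ) ^ k * (y - y') ∈ 2 • H - 2 • H)
    {L : ℕ} (hL : 1 ≤ L) (hRT : 2 * (A.card * T.card) ≤ 2 ^ L) (hTL : 4 * L ≤ T.card) :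
    A.card ^ 2 * T.card * Y.card ≤
      4 * (3 • H - 2 • H).card * (T.card * A.card + Y.card * (4 * L * C)) := by
  classical
  set R := A.image (fun a => (ρ a : ℚ)) with hR
  have hρinj : Set.InjOn (fun a => (ρ a : ℚ)) A := by
    intro a ha b hb h
    have h' : ρ a = ρ b := by simpa using h
    rw [← hρ a ha, ← hρ b hb, h']
  have hRc : R.card = A.card := card_image_of_injOn hρinj
  have hR0 : (0 : ℚ) ∉ R := by
    intro h
    obtain ⟨a, ha, h0⟩ := mem_image.1 h
    have : ρ a = 0 := by exact_mod_cast h0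
    have h1 := hρ a ha
    rw [this, zero_pow hk.ne'] at h1
    exact hA0 (h1 ▸ ha)
  set low : ℤ → ℕ → Prop := fun a t =>
    (T.filter (fun r : ℕ => (r : ℚ) * ((ρ a : ℚ) / t) ∈ R)).card ≤ 4 * L with hlow
  set S : ℕ → Finset ℤ := fun t => A.filter (fun a => low a t) with hS
  set N := (3 • H - 2 • H).card with hN
  have hmany : A.card * T.card ≤ 2 * ∑ t ∈ T, (S t).card := by
    have h1 := card_low_degree_pairs hR0 hT hL (by rwa [hRc]) hTL
    rw [hRc] at h1
    refine h1.trans (Nat.mul_le_mul_left _ ?_)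
    rw [← card_sigma]
    refine card_le_card_of_surjOn (fun q : (_ : ℕ) × ℤ => ((ρ q.2 : ℚ), q.1)) ?_
    rintro ⟨x, t⟩ hp
    obtain ⟨hp1, hp2⟩ := mem_filter.1 (mem_coe.1 hp)
    obtain ⟨hx, ht⟩ := mem_product.1 hp1
    obtain ⟨a, ha, rfl⟩ := mem_image.1 hx
    exact ⟨⟨t, a⟩, mem_coe.2 (mem_sigma.2 ⟨ht, mem_filter.2 ⟨ha, hp2⟩⟩), rfl⟩
  obtain ⟨y₀, hy₀⟩ := hYne
  have hYpos : 0 < Y.card := card_pos.2 ⟨y₀, hy₀⟩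
  set O : ℕ → Finset ((ℤ × ℤ) × (ℤ × ℤ)) := fun t =>
    ((S t ×ˢ Y) ×ˢ (S t ×ˢ Y)).filter (fun p =>
      p.1.1 + (t : ℤ) ^ k * p.1.2 = p.2.1 + (t : ℤ) ^ k * p.2.2 ∧ p.1.2 ≠ p.2.2) with hO
  have hcs : ∀ t ∈ T, ((S t).card * Y.card) ^ 2 ≤ N * (A.card * Y.card + (O t).card) := by
    intro t ht
    set f : ℤ × ℤ → ℤ := fun p => p.1 + (t : ℤ) ^ k * p.2 with hf
    have h1 := sq_card_le_card_mul_card_collisions (S t ×ˢ Y)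
      ((3 • H - 2 • H).image (· + (t : ℤ) ^ k * y₀)) f (by
        intro p hp
        obtain ⟨hp1, hp2⟩ := mem_product.1 hp
        obtain ⟨u, hu, v, hv, huv⟩ := mem_sub.1 (hY t ht _ hp2 _ hy₀)
        refine mem_image.2 ⟨p.1 + u - v, mem_sub.2 ⟨p.1 + u, ?_, v, hv, rfl⟩, ?_⟩
        · rw [succ_nsmul']
          exact add_mem_add (hAH (mem_filter.1 hp1).1) hu
        · rw [hf]
          simp only
          rw [mul_sub] at huv
          linarith)
    rw [card_product] at h1
    refine h1.trans (Nat.mul_le_mul card_image_le ?_)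
    have hsub : ((S t ×ˢ Y) ×ˢ (S t ×ˢ Y)).filter (fun p => f p.1 = f p.2) ⊆
        (A ×ˢ Y).image (fun q => (q, q)) ∪ O t := by
      rintro ⟨⟨a, y⟩, ⟨a', y'⟩⟩ hp
      obtain ⟨hp1, hp2⟩ := mem_filter.1 hp
      have hp2' : a + (t : ℤ) ^ k * y = a' + (t : ℤ) ^ k * y' := hp2
      rw [mem_union]
      by_cases hyy : y = y'
      · left
        subst hyy
        have : a = a' := by linarith
        subst this
        have h3 := mem_product.1 (mem_product.1 hp1).1
        exact mem_image.2 ⟨(a, y), mem_product.2 ⟨(mem_filter.1 h3.1).1, h3.2⟩, rfl⟩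
      · right
        exact mem_filter.2 ⟨hp1, hp2', hyy⟩
    refine (card_le_card hsub).trans ((card_union_le _ _).trans ?_)
    exact Nat.add_le_add_right (card_image_le.trans_eq (card_product _ _)) _
  have hoff : ∑ t ∈ T, (O t).card ≤ Y.card ^ 2 * (4 * L * C) := by
    rw [← card_sigma, sq, ← card_product]
    have hm := card_eq_sum_card_fiberwise (s := T.sigma O) (t := Y ×ˢ Y)
      (f := fun q => (q.2.1.2, q.2.2.2)) (by
        intro q hq
        have h1 := mem_product.1 (mem_filter.1 (mem_sigma.1 hq).2).1
        exact mem_product.2 ⟨(mem_product.1 h1.1).2, (mem_product.1 h1.2).2⟩)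
    rw [hm, ← smul_eq_mul]
    refine sum_le_card_nsmul _ _ _ ?_
    rintro ⟨y, y'⟩ -
    by_cases hyy : y = y'
    · rw [card_eq_zero.2]
      · exact Nat.zero_le _
      rw [filter_eq_empty_iff]
      rintro q hq h
      refine (mem_filter.1 (mem_sigma.1 hq).2).2.2 ?_
      obtain ⟨e1, e2⟩ := Prod.mk.inj h
      rw [e1, e2, hyy]
    refine le_trans ?_ (card_low_degree_solutions_le hU hρ hT (4 * L)
      (n := y' - y) (sub_ne_zero.2 (Ne.symm hyy)))
    refine card_le_card_of_injOn (fun q => (q.1, (q.2.1.1, q.2.2.1))) ?_ ?_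
    · intro q hq
      obtain ⟨hq1, hq2⟩ := mem_filter.1 hq
      obtain ⟨ht, hqO⟩ := mem_sigma.1 hq1
      obtain ⟨hq3, hq4, -⟩ := mem_filter.1 hqO
      have h1 := mem_product.1 hq3
      have h2 := mem_filter.1 (mem_product.1 h1.1).1
      have h3 := mem_filter.1 (mem_product.1 h1.2).1
      obtain ⟨e1, e2⟩ := Prod.mk.inj hq2
      rw [e1, e2] at hq4
      refine mem_filter.2 ⟨mem_product.2 ⟨ht, mem_product.2 ⟨h2.1, h3.1⟩⟩, h2.2, ?_⟩
      change q.2.1.1 - q.2.2.1 = (q.1 : ℤ) ^ k * (y' - y)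
      rw [mul_sub]
      linarith
    · rintro ⟨t, ⟨a, b⟩, ⟨a', b'⟩⟩ hq ⟨r, ⟨c, d⟩, ⟨c', d'⟩⟩ hr h
      have hq2 := (mem_filter.1 hq).2
      have hr2 := (mem_filter.1 hr).2
      simp only [Prod.mk.injEq] at h hq2 hr2
      obtain ⟨rfl, rfl, rfl⟩ := h
      obtain ⟨rfl, rfl⟩ := hq2
      obtain ⟨rfl, rfl⟩ := hr2
      rfl
  have hsumsq : (∑ t ∈ T, (S t).card) ^ 2 ≤ T.card * ∑ t ∈ T, (S t).card ^ 2 :=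
    sq_sum_le_card_mul_sum_sq
  have htot : (∑ t ∈ T, (S t).card ^ 2) * Y.card ^ 2 ≤
      N * (T.card * (A.card * Y.card) + Y.card ^ 2 * (4 * L * C)) := by
    calc (∑ t ∈ T, (S t).card ^ 2) * Y.card ^ 2 = ∑ t ∈ T, ((S t).card * Y.card) ^ 2 := by
          rw [sum_mul]; exact sum_congr rfl fun t _ => by ring
      _ ≤ ∑ t ∈ T, N * (A.card * Y.card + (O t).card) := sum_le_sum hcs
      _ = N * (T.card * (A.card * Y.card) + ∑ t ∈ T, (O t).card) := by
          rw [← mul_sum, sum_add_distrib, sum_const, smul_eq_mul]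
      _ ≤ _ := by gcongr
  have hTpos : 0 < T.card := by omega
  refine Nat.le_of_mul_le_mul_right (c := T.card * Y.card) ?_ (Nat.mul_pos hTpos hYpos)
  calc A.card ^ 2 * T.card * Y.card * (T.card * Y.card)
      = (A.card * T.card) ^ 2 * Y.card ^ 2 := by ring
    _ ≤ (2 * ∑ t ∈ T, (S t).card) ^ 2 * Y.card ^ 2 := by gcongr
    _ = 4 * (∑ t ∈ T, (S t).card) ^ 2 * Y.card ^ 2 := by ring
    _ ≤ 4 * (T.card * ∑ t ∈ T, (S t).card ^ 2) * Y.card ^ 2 := by gcongr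
    _ = 4 * T.card * ((∑ t ∈ T, (S t).card ^ 2) * Y.card ^ 2) := by ring
    _ ≤ 4 * T.card * (N * (T.card * (A.card * Y.card) + Y.card ^ 2 * (4 * L * C))) := by gcongr
    _ = _ := by ring

/-- A quantitative form of `exists_dilatable_subset`, with sizes written as powers of two. -/
theorem exists_large_dilatable_subset {H : Finset ℤ} {l κ : ℝ} (hκ : 1 ≤ κ)
    (hHl : (H.card : ℝ) = 2 ^ l) (hd : ((H + H).card : ℝ) ≤ 2 ^ κ * H.card) {s : ℕ} (hs : 1 ≤ s)
    (hsl : 9240 * ((s : ℝ) ^ 3 * κ ^ 2) ≤ l) :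
    ∃ Y ⊆ H, (H.card : ℝ) ≤ 2 ^ (l / 4) * Y.card ∧
      ∀ y ∈ Y, ∀ y' ∈ Y, ∀ N : ℕ, N < 2 ^ s → (N : ℤ) * (y - y') ∈ 2 • H - 2 • H := by
  have hpos : (0 : ℝ) < H.card := by rw [hHl]; positivity
  have hne : H.Nonempty := card_pos.1 (by exact_mod_cast hpos)
  have hK2 : (2 : ℝ) ≤ 2 ^ κ := by
    simpa using Real.rpow_le_rpow_of_exponent_le (by norm_num : (1 : ℝ) ≤ 2) hκ
  have hKe : (2 : ℝ) ^ κ ≤ Real.exp κ := by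
    rw [Real.rpow_def_of_pos two_pos]
    have := Real.log_two_lt_d9
    exact Real.exp_le_exp.2 (by nlinarith)
  have hs' : (1 : ℝ) ≤ s := by exact_mod_cast hs
  set m := ⌈48 ^ 2 * (s : ℝ) ^ 2 * κ⌉₊ with hm
  obtain ⟨Y, hYH, hY, hdil⟩ := exists_dilatable_subset hne hK2 hκ hKe hd hs (Nat.le_ceil _)
  refine ⟨Y, hYH, hY.trans ?_, hdil⟩
  refine mul_le_mul_of_nonneg_right ?_ (Nat.cast_nonneg _)
  have h2 : ((2 : ℝ) * (2 ^ κ) ^ m) ^ s * ((2 ^ κ) ^ (3 * s + 1)) ^ s =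
      2 ^ ((s : ℝ) + (m + (3 * s + 1)) * s * κ) := by
    rw [mul_pow, ← pow_mul, ← pow_mul, mul_assoc, ← pow_add, ← Real.rpow_natCast 2 s,
      ← Real.rpow_natCast (2 ^ κ), ← Real.rpow_mul two_pos.le, ← Real.rpow_add two_pos]
    congr 1
    push_cast
    ring
  rw [h2]
  refine Real.rpow_le_rpow_of_exponent_le (by norm_num) ?_
  have hmlt : (m : ℝ) ≤ 48 ^ 2 * (s : ℝ) ^ 2 * κ + 1 := (Nat.ceil_lt_add_one (by positivity)).le
  have e1 : 1 ≤ (s : ℝ) ^ 2 * κ := one_le_mul_of_one_le_of_one_le (one_le_pow₀ hs') hκ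
  have e2 : (s : ℝ) ≤ (s : ℝ) ^ 2 * κ := by nlinarith
  have e3 : (m : ℝ) + (3 * s + 1) ≤ 2309 * ((s : ℝ) ^ 2 * κ) := by linarith
  have e4 : (s : ℝ) ≤ (s : ℝ) ^ 3 * κ ^ 2 := by
    have : 1 ≤ (s : ℝ) ^ 2 * κ ^ 2 :=
      one_le_mul_of_one_le_of_one_le (one_le_pow₀ hs') (one_le_pow₀ hκ)
    nlinarith
  have e5 := mul_le_mul_of_nonneg_right e3 (by positivity : 0 ≤ (s : ℝ) * κ)
  nlinarith

/-- A Chebyshev-type lower bound for the number of primes up to `2 ^ e`. -/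
theorem two_pow_le_mul_card_primesLE {e : ℕ} (he : 3 ≤ e) :
    2 ^ e ≤ 2 * e * (Nat.primesLE (2 ^ e)).card := by
  have h := Chebyshev.pi_ge (2 ^ e)
  rw [← Nat.primesLE_card_eq_primeCounting] at h
  set P := (Nat.primesLE (2 ^ e)).card
  have hlog := Real.log_pos one_lt_two
  have he' : (3 : ℝ) ≤ e := by exact_mod_cast he
  push_cast at h
  rw [Real.log_pow, div_le_iff₀ (by positivity)] at h
  have h1 : Real.log (2 ^ e + 1) ≤ (e + 1) * Real.log 2 := by
    have : (e + 1) * Real.log 2 = Real.log (2 ^ (e + 1)) := by rw [Real.log_pow]; push_cast; ring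
    rw [this]
    refine Real.log_le_log (by positivity) ?_
    have : (1 : ℝ) ≤ 2 ^ e := one_le_pow₀ (by norm_num)
    rw [pow_succ]
    linarith
  have h2 : (2 : ℝ) ^ e ≤ P * e + (e + 1) := by
    refine le_of_mul_le_mul_right (a := Real.log 2) ?_ hlog
    nlinarith
  have h3 : ∀ n : ℕ, 3 ≤ n → 2 * (n + 1) ≤ 2 ^ n := by
    intro n hn
    induction n, hn using Nat.le_induction with
    | base => norm_num
    | succ n hn ih => rw [pow_succ]; omega
  have h4 : 2 ^ e ≤ P * e + (e + 1) := by exact_mod_cast h2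
  have h5 := h3 e he
  nlinarith

/-- The final optimisation: here `a`, `t`, `y`, `N` are the sizes of the set of powers, the set of
primes, the set of dilatable elements and `3H - 2H`. -/
theorem le_of_sq_mul_mul_le {a t y N L C e l κ u : ℝ} (ha : 0 ≤ a) (ht : 0 < t) (hy : 0 < y)
    (hN0 : 0 ≤ N) (hC : 1 ≤ C) (he0 : 0 < e) (he : 42 * e ≤ l) (hL0 : 0 ≤ L)
    (hL : L ≤ 4 * l)
    (hN : N ≤ 2 ^ (5 * κ) * 2 ^ l) (hyl : 2 ^ l ≤ 2 ^ (l / 4) * y)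
    (htE : 2 ^ e ≤ 2 * e * t)
    (hgain : 256 * l ^ 2 * 2 ^ (5 * κ) * 2 ^ (u / 2) ≤ 2 ^ e)
    (hκ : 3 + 5 * κ + u / 4 ≤ l / 4)
    (hcore : a ^ 2 * t * y ≤ 4 * N * (t * a + y * (4 * L * C))) :
    a ≤ 2 * C * (2 ^ (l / 2) * 2 ^ (-(u / 4))) := by
  have hl : 0 < l := by linarith
  set B : ℝ := 2 ^ (l / 2) * 2 ^ (-(u / 4)) with hB
  have hBpos : 0 < B := by positivity
  have hB2 : B ^ 2 * 2 ^ (u / 2) = 2 ^ l := by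
    rw [hB, ← Real.rpow_add two_pos, ← Real.rpow_natCast, ← Real.rpow_mul two_pos.le,
      ← Real.rpow_add two_pos]
    congr 1
    push_cast
    ring
  rcases le_total (t * a) (y * (4 * L * C)) with hcase | hcase
  · have h1 : a ^ 2 * t ≤ 32 * N * (L * C) := by
      refine le_of_mul_le_mul_right (a := y) ?_ hy
      have := mul_le_mul_of_nonneg_left hcase (by positivity : (0 : ℝ) ≤ 4 * N)
      linarith
    have h2 : a ^ 2 * 2 ^ e ≤ 2 ^ l * (256 * l ^ 2 * 2 ^ (5 * κ)) * C := by
      calc a ^ 2 * 2 ^ e ≤ a ^ 2 * (2 * e * t) := by gcongr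
        _ = 2 * e * (a ^ 2 * t) := by ring
        _ ≤ 2 * e * (32 * N * (L * C)) := by gcongr
        _ ≤ 2 * (l / 42) * (32 * (2 ^ (5 * κ) * 2 ^ l) * (4 * l * C)) := by
            gcongr
            linarith
        _ = (256 / 42) * (2 ^ l * l ^ 2 * 2 ^ (5 * κ) * C) := by ring
        _ ≤ 256 * (2 ^ l * l ^ 2 * 2 ^ (5 * κ) * C) := by gcongr; norm_num
        _ = _ := by ring
    have h3 : a ^ 2 ≤ B ^ 2 * C := by
      refine le_of_mul_le_mul_right (a := (2 : ℝ) ^ e) ?_ (by positivity)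
      refine h2.trans ?_
      rw [← hB2]
      calc B ^ 2 * 2 ^ (u / 2) * (256 * l ^ 2 * 2 ^ (5 * κ)) * C
          = B ^ 2 * C * (256 * l ^ 2 * 2 ^ (5 * κ) * 2 ^ (u / 2)) := by ring
        _ ≤ _ := by gcongr
    refine le_of_sq_le_sq ?_ (by positivity)
    have h4 : B ^ 2 * C ≤ B ^ 2 * (4 * C ^ 2) := by gcongr; nlinarith
    linarith
  · rcases ha.eq_or_lt with h0 | h0
    · rw [← h0]; positivity
    have h1 : a ^ 2 * y ≤ 8 * N * a := by
      refine le_of_mul_le_mul_right (a := t) ?_ ht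
      have := mul_le_mul_of_nonneg_left hcase (by positivity : (0 : ℝ) ≤ 4 * N)
      linarith
    have h2 : a * y ≤ 8 * (2 ^ (5 * κ) * 2 ^ l) := by
      refine le_of_mul_le_mul_right (a := a) ?_ h0
      have := mul_le_mul_of_nonneg_right hN h0.le
      linarith
    have h3 : a * 2 ^ l ≤ 2 ^ (3 + 5 * κ + l / 4) * 2 ^ l := by
      calc a * 2 ^ l ≤ a * (2 ^ (l / 4) * y) := by gcongr
        _ = (a * y) * 2 ^ (l / 4) := by ring
        _ ≤ 8 * (2 ^ (5 * κ) * 2 ^ l) * 2 ^ (l / 4) := by gcongr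
        _ = _ := by
            rw [Real.rpow_add two_pos, Real.rpow_add two_pos,
              (by norm_num : (2 : ℝ) ^ (3 : ℝ) = 8)]
            ring
    have h4 := le_of_mul_le_mul_right h3 (by positivity)
    have h5 : (2 : ℝ) ^ (3 + 5 * κ + l / 4) ≤ B := by
      rw [hB, ← Real.rpow_add two_pos]
      exact Real.rpow_le_rpow_of_exponent_le (by norm_num) (by linarith)
    nlinarith

/-- The bound for sets `H` of size `2 ^ l` and doubling `2 ^ κ`, where `l = x ^ 3 * κ ^ 2` is
large in terms of `κ`. -/
theorem card_kth_powers_le_of_large {k C : ℕ} (hk : 0 < k) (hC : 1 ≤ C) (hU : Uk k C)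
    {A H : Finset ℤ} (hA : ∀ a ∈ A, ∃ m : ℤ, a = m ^ k) (hAH : A ⊆ H) {l κ x : ℝ}
    (hl : 1 ≤ l) (hκ : 1 ≤ κ) (hx : 0 ≤ x) (hxl : x ^ 3 * κ ^ 2 = l)
    (hHl : (H.card : ℝ) = 2 ^ l) (hd : ((H + H).card : ℝ) ≤ 2 ^ κ * H.card)
    (hbig : 10 + 2 * Real.logb 2 l + 5 * κ ≤ x / (21 * (k + 1)) / 2) :
    (A.card : ℝ) ≤ 4 * C * 2 ^ (l / 2) * 2 ^ (-(x / (21 * (k + 1)) / 4)) := by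
  have hk' : (1 : ℝ) ≤ k := by exact_mod_cast hk
  have hC' : (1 : ℝ) ≤ C := by exact_mod_cast hC
  have hlpos : 0 < l := by linarith
  set u := x / (21 * (k + 1)) with hu
  have hu0 : 0 ≤ u := by positivity
  have hxu : x = u * (21 * (k + 1)) := by rw [hu]; field_simp
  have hlog0 : 0 ≤ Real.logb 2 l := Real.logb_nonneg one_lt_two hl
  have hu30 : 30 ≤ u := by linarith
  have hul : 42 * u ≤ l := by
    have h1 : 42 * u ≤ x := by rw [hxu]; nlinarith
    have h2 : x ≤ x ^ 3 := le_self_pow₀ (by linarith) (by norm_num)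
    have h3 : x ^ 3 ≤ x ^ 3 * κ ^ 2 := le_mul_of_one_le_right (by positivity) (one_le_pow₀ hκ)
    linarith
  set e := ⌊u⌋₊ with he
  have heu : (e : ℝ) ≤ u := Nat.floor_le hu0
  have heu' : u < e + 1 := Nat.lt_floor_add_one u
  have he3 : 3 ≤ e := Nat.le_floor (by push_cast; linarith)
  have he3' : (3 : ℝ) ≤ e := by exact_mod_cast he3
  have hsl : 9240 * (((k * e + 1 : ℕ) : ℝ) ^ 3 * κ ^ 2) ≤ l := by
    have h1 : ((k * e + 1 : ℕ) : ℝ) ≤ x / 21 := by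
      push_cast
      rw [hxu]
      nlinarith
    have h2 : ((k * e + 1 : ℕ) : ℝ) ^ 3 ≤ (x / 21) ^ 3 := by gcongr
    have h3 := mul_le_mul_of_nonneg_right h2 (sq_nonneg κ)
    have h4 : (x / 21) ^ 3 * κ ^ 2 = l / 9261 := by rw [← hxl]; ring
    linarith
  obtain ⟨Y, hYH, hYc, hY⟩ := exists_large_dilatable_subset hκ hHl hd (Nat.succ_pos _) hsl
  set T := Nat.primesLE (2 ^ e) with hT
  have hTp : ∀ t ∈ T, t.Prime := fun t ht => Nat.prime_of_mem_primesLE ht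
  have hTc : (2 : ℝ) ^ e ≤ 2 * e * T.card := by exact_mod_cast two_pow_le_mul_card_primesLE he3
  have hTle : (T.card : ℝ) ≤ 2 ^ e := by
    have : T.card ≤ 2 ^ e := by
      refine (card_le_card (t := Icc 1 (2 ^ e)) fun t ht => ?_).trans (Nat.card_Icc 1 _).le
      exact mem_Icc.2 ⟨(hTp t ht).one_le, Nat.le_of_mem_primesLE ht⟩
    exact_mod_cast this
  choose! ρ hρ using hA
  set A' := A.erase 0 with hA'
  have hρ' : ∀ a ∈ A', ρ a ^ k = a := fun a ha => (hρ a (mem_of_mem_erase ha)).symm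
  set L := ⌈2 * l⌉₊ + 1 with hL
  have hLle : (L : ℝ) ≤ 4 * l := by
    have := (Nat.ceil_lt_add_one (by positivity : 0 ≤ 2 * l)).le
    rw [hL]
    push_cast
    linarith
  have hHpos : (0 : ℝ) < H.card := by rw [hHl]; positivity
  have hYpos : (0 : ℝ) < Y.card := by
    by_contra h
    have : (2 : ℝ) ^ (l / 4) * Y.card ≤ 0 := mul_nonpos_of_nonneg_of_nonpos (by positivity)
      (not_lt.1 h)
    linarith
  have hA'H : (A'.card : ℝ) ≤ 2 ^ l := by
    rw [← hHl]
    exact_mod_cast card_le_card ((erase_subset _ _).trans hAH)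
  have hel : (2 : ℝ) ^ e ≤ 2 ^ l := by
    rw [← Real.rpow_natCast]
    exact Real.rpow_le_rpow_of_exponent_le (by norm_num) (by linarith)
  have hlo : (2 : ℝ) ^ Real.logb 2 l = l := Real.rpow_logb two_pos (by norm_num) hlpos
  -- the gain from the primes beats all the polynomial losses
  have hgain : 256 * l ^ 2 * 2 ^ (5 * κ) * 2 ^ (u / 2) ≤ (2 : ℝ) ^ e := by
    have h1 : 256 * l ^ 2 * 2 ^ (5 * κ) * 2 ^ (u / 2) =
        (2 : ℝ) ^ (8 + 2 * Real.logb 2 l + 5 * κ + u / 2) := by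
      rw [Real.rpow_add two_pos, Real.rpow_add two_pos, Real.rpow_add two_pos,
        mul_comm 2 (Real.logb 2 l), Real.rpow_mul two_pos.le (Real.logb 2 l), hlo,
        Real.rpow_two, (by norm_num : (2 : ℝ) ^ (8 : ℝ) = 256)]
    rw [h1, ← Real.rpow_natCast]
    exact Real.rpow_le_rpow_of_exponent_le (by norm_num) (by linarith)
  have hone : ∀ y : ℝ, 0 ≤ y → (1 : ℝ) ≤ 2 ^ y := fun y hy =>
    Real.one_le_rpow (by norm_num) hy
  have hTL : 4 * L ≤ T.card := by
    have h1 : 256 * l ^ 2 ≤ (2 : ℝ) ^ e := by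
      refine le_trans ?_ hgain
      have h2 := one_le_mul_of_one_le_of_one_le (hone (5 * κ) (by linarith))
        (hone (u / 2) (by linarith))
      rw [mul_assoc]
      exact le_mul_of_one_le_right (by positivity) h2
    have h3 : (4 * L : ℝ) ≤ T.card := by
      refine le_of_mul_le_mul_left (a := 2 * (e : ℝ)) ?_ (by positivity)
      nlinarith
    exact_mod_cast h3
  have hRT : 2 * (A'.card * T.card) ≤ 2 ^ L := by
    have h1 : (2 : ℝ) ^ (2 * l) ≤ 2 ^ ⌈2 * l⌉₊ := by
      rw [← Real.rpow_natCast]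
      exact Real.rpow_le_rpow_of_exponent_le (by norm_num) (Nat.le_ceil _)
    have h2 : (A'.card : ℝ) * T.card ≤ 2 ^ l * 2 ^ l :=
      mul_le_mul hA'H (hTle.trans hel) (Nat.cast_nonneg _) (by positivity)
    rw [← Real.rpow_add two_pos, ← two_mul] at h2
    have h3 : (2 * (A'.card * T.card) : ℝ) ≤ 2 ^ L := by
      rw [hL, pow_succ]
      linarith
    exact_mod_cast h3
  have hcore := sq_card_kth_powers_mul_le hk hU hρ' (notMem_erase _ _)
    ((erase_subset _ _).trans hAH) hTp (card_pos.1 (by exact_mod_cast hYpos)) (by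
      intro t ht y hy y' hy'
      have := hY y hy y' hy' (t ^ k) (by
        refine (Nat.pow_le_pow_left (Nat.le_of_mem_primesLE ht) k).trans_lt ?_
        rw [← pow_mul, mul_comm e k]
        exact Nat.pow_lt_pow_right one_lt_two (Nat.lt_succ_self _))
      push_cast at this
      exact this) (Nat.succ_pos _) hRT hTL
  have hN : ((3 • H - 2 • H).card : ℝ) ≤ 2 ^ (5 * κ) * 2 ^ l := by
    have := card_nsmul_sub_nsmul_le (card_pos.1 (by exact_mod_cast hHpos)) hd 3 2
    rw [← Real.rpow_natCast, ← Real.rpow_mul two_pos.le, hHl] at this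
    convert this using 3
    push_cast
    ring
  set N := (3 • H - 2 • H).card
  have hTpos : (0 : ℝ) < T.card := by
    have h1 : 0 < T.card := by omega
    exact_mod_cast h1
  have hcoreR : (A'.card : ℝ) ^ 2 * T.card * Y.card ≤
      4 * N * (T.card * A'.card + Y.card * (4 * L * C)) := by exact_mod_cast hcore
  have hmain : (A'.card : ℝ) ≤ 2 * C * (2 ^ (l / 2) * 2 ^ (-(u / 4))) :=
    le_of_sq_mul_mul_le (e := e) (Nat.cast_nonneg _) hTpos hYpos (Nat.cast_nonneg _) hC'
      (by linarith) (by linarith) (Nat.cast_nonneg _) hLle hN (hHl ▸ hYc)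
      (by rwa [Real.rpow_natCast]) (by rwa [Real.rpow_natCast])
      (by linarith) hcoreR
  have hB1 : 1 ≤ (2 : ℝ) ^ (l / 2) * 2 ^ (-(u / 4)) := by
    rw [← Real.rpow_add two_pos]
    exact hone _ (by linarith)
  have hAA : (A.card : ℝ) ≤ A'.card + 1 := by
    have : A.card - 1 ≤ A'.card := pred_card_le_card_erase
    exact_mod_cast (by omega : A.card ≤ A'.card + 1)
  rw [mul_assoc (4 * (C : ℝ))]
  nlinarith

/-- Powers of `l` dominate the logarithmic and lower order terms. -/
theorem exists_forall_lower_order_le {α δ : ℝ} (hα : α < 1 / 11) (hδ : 0 < δ) :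
    ∃ l₀ : ℝ, 1 ≤ l₀ ∧ ∀ l κ : ℝ, l₀ ≤ l → 1 ≤ κ → κ ≤ l ^ α →
      10 + 2 * Real.logb 2 l + 5 * κ ≤ δ * (l / κ ^ 2) ^ ((1 : ℝ) / 3) := by
  have h1 : (fun l : ℝ => (10 : ℝ)) =o[Filter.atTop] fun l : ℝ => l ^ ((3 : ℝ) / 11) :=
    (Asymptotics.isLittleO_const_left.2 (Or.inr (tendsto_norm_atTop_atTop.comp
      (tendsto_rpow_atTop (by norm_num)))))
  have h2 : (fun l : ℝ => 2 * Real.logb 2 l) =o[Filter.atTop] fun l : ℝ => l ^ ((3 : ℝ) / 11) := by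
    have := (isLittleO_log_rpow_atTop (by norm_num : (0 : ℝ) < 3 / 11)).const_mul_left
      (2 / Real.log 2)
    refine this.congr_left fun l => ?_
    rw [Real.logb]
    ring
  have h3 : (fun l : ℝ => 5 * l ^ ((1 : ℝ) / 11)) =o[Filter.atTop]
      fun l : ℝ => l ^ ((3 : ℝ) / 11) :=
    by
    refine (Asymptotics.isLittleO_of_tendsto' ?_ ?_).const_mul_left 5
    · filter_upwards [Filter.eventually_gt_atTop 0] with l hl h
      exact absurd h (by positivity)
    · refine (tendsto_rpow_neg_atTop (by norm_num : (0 : ℝ) < 2 / 11)).congr' ?_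
      filter_upwards [Filter.eventually_gt_atTop 0] with l hl
      rw [← Real.rpow_sub hl]
      norm_num
  obtain ⟨l₀, hl₀⟩ := Filter.eventually_atTop.1 (((h1.add h2).add h3).bound hδ)
  refine ⟨max l₀ 1, le_max_right _ _, fun l κ hl hκ hκl => ?_⟩
  have hl1 : 1 ≤ l := (le_max_right _ _).trans hl
  have hlpos : 0 < l := by linarith
  have hκl' : κ ≤ l ^ ((1 : ℝ) / 11) :=
    hκl.trans (Real.rpow_le_rpow_of_exponent_le hl1 hα.le)
  have hb := hl₀ l ((le_max_left _ _).trans hl)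
  rw [Real.norm_of_nonneg (by positivity : 0 ≤ l ^ ((3 : ℝ) / 11))] at hb
  have hx : l ^ ((3 : ℝ) / 11) ≤ (l / κ ^ 2) ^ ((1 : ℝ) / 3) := by
    have h4 : l ^ ((9 : ℝ) / 11) ≤ l / κ ^ 2 := by
      rw [le_div_iff₀ (by positivity)]
      calc l ^ ((9 : ℝ) / 11) * κ ^ 2 ≤ l ^ ((9 : ℝ) / 11) * (l ^ ((1 : ℝ) / 11)) ^ 2 := by gcongr
        _ = l := by
          rw [← Real.rpow_natCast, ← Real.rpow_mul hlpos.le, ← Real.rpow_add hlpos]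
          norm_num
    calc l ^ ((3 : ℝ) / 11) = (l ^ ((9 : ℝ) / 11)) ^ ((1 : ℝ) / 3) := by
          rw [← Real.rpow_mul hlpos.le]; norm_num
      _ ≤ _ := Real.rpow_le_rpow (by positivity) h4 (by norm_num)
  have h5 := (le_abs_self _).trans hb
  have h6 := mul_le_mul_of_nonneg_left hx hδ.le
  linarith

/-- conditionally, a set of `k`-th powers (`k > 3`) inside a set `H` of small
doubling `K` has size at most `C₁·|H|^{1/2}·exp(−c·(log |H| / (log K)²)^{1/3})`. -/
theorem kth_powers_in_small_doubling (k : ℕ) (hk : 3 < k) (C : ℕ) (hC : 1 ≤ C)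
    (hU : Uk k C) :
    ∀ α : ℝ, 0 < α → α < 1 / 11 →
      ∃ c C₁ : ℝ, 0 < c ∧ 1 ≤ C₁ ∧
        ∀ (A : Finset ℤ), (∀ a ∈ A, ∃ m : ℤ, a = m ^ k) →
        ∀ (H : Finset ℤ), A ⊆ H → 2 ≤ H.card →
        ∀ (K : ℝ), 2 ≤ K →
          ((H + H).card : ℝ) ≤ K * (H.card : ℝ) →
          Real.logb 2 K ≤ (Real.logb 2 (H.card : ℝ)) ^ α →
          (A.card : ℝ) ≤
            C₁ * (H.card : ℝ) ^ ((1 : ℝ) / 2) *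
              Real.exp (-c * (Real.logb 2 (H.card : ℝ) / (Real.logb 2 K) ^ 2)
                ^ ((1 : ℝ) / 3)) := by
  intro α _ hα
  set δ : ℝ := 1 / (21 * (k + 1)) with hδ
  have hδ0 : 0 < δ := by positivity
  obtain ⟨l₀, hl₀1, hl₀⟩ := exists_forall_lower_order_le hα (by positivity : 0 < δ / 2)
  have hlog := Real.log_pos one_lt_two
  set c : ℝ := Real.log 2 * (δ / 4) with hc
  have hc0 : 0 < c := by positivity
  have hC' : (1 : ℝ) ≤ C := by exact_mod_cast hC
  have hbd : (1 : ℝ) ≤ 2 ^ l₀ * Real.exp (c * l₀) :=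
    one_le_mul_of_one_le_of_one_le (Real.one_le_rpow (by norm_num) (by linarith))
      (Real.one_le_exp (by positivity))
  refine ⟨c, 4 * C + 2 ^ l₀ * Real.exp (c * l₀), hc0, by linarith, ?_⟩
  intro A hA H hAH hH K hK hd hκα
  have hH' : (2 : ℝ) ≤ H.card := by exact_mod_cast hH
  set l := Real.logb 2 (H.card : ℝ) with hl
  set κ := Real.logb 2 K with hκ
  have hl1 : 1 ≤ l := by
    rw [hl, Real.le_logb_iff_rpow_le one_lt_two (by linarith)]
    simpa using hH'
  have hκ1 : 1 ≤ κ := by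
    rw [hκ, Real.le_logb_iff_rpow_le one_lt_two (by linarith)]
    simpa using hK
  have hHl : (H.card : ℝ) = 2 ^ l := (Real.rpow_logb two_pos (by norm_num) (by linarith)).symm
  have hKκ : K = 2 ^ κ := (Real.rpow_logb two_pos (by norm_num) (by linarith)).symm
  set x := (l / κ ^ 2) ^ ((1 : ℝ) / 3) with hx
  have hq : 0 ≤ l / κ ^ 2 := by positivity
  have hx0 : 0 ≤ x := by positivity
  have hx3 : x ^ 3 = l / κ ^ 2 := by
    rw [hx, ← Real.rpow_natCast, ← Real.rpow_mul hq]
    norm_num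
  rcases le_total l₀ l with hcase | hcase
  · have hbig := hl₀ l κ hcase hκ1 hκα
    have hδx : x / (21 * (k + 1)) = δ * x := by rw [hδ]; ring
    have h := card_kth_powers_le_of_large (by omega) hC hU hA hAH hl1 hκ1 hx0
      (by rw [hx3]; field_simp) hHl (by rwa [← hKκ]) (by rw [hδx]; linarith)
    refine h.trans ?_
    have h1 : (2 : ℝ) ^ (l / 2) = (H.card : ℝ) ^ ((1 : ℝ) / 2) := by
      rw [hHl, ← Real.rpow_mul two_pos.le]
      congr 1
      ring
    have h2 : (2 : ℝ) ^ (-(x / (21 * (k + 1)) / 4)) = Real.exp (-c * x) := by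
      rw [Real.rpow_def_of_pos two_pos, hδx, hc]
      congr 1
      ring
    rw [h1, h2]
    have h3 : 4 * (C : ℝ) ≤ 4 * C + 2 ^ l₀ * Real.exp (c * l₀) := by linarith
    exact mul_le_mul_of_nonneg_right (mul_le_mul_of_nonneg_right h3
      (Real.rpow_nonneg (by linarith) _)) (Real.exp_pos _).le
  · have hxl : x ≤ l₀ := by
      refine le_trans ?_ hcase
      calc x ≤ l ^ ((1 : ℝ) / 3) := Real.rpow_le_rpow hq
            (div_le_self (by linarith) (one_le_pow₀ hκ1)) (by norm_num)
        _ ≤ l := Real.rpow_le_self_of_one_le hl1 (by norm_num)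
    have hA2 : (A.card : ℝ) ≤ 2 ^ l₀ := by
      have h1 : (A.card : ℝ) ≤ H.card := by exact_mod_cast card_le_card hAH
      rw [hHl] at h1
      exact h1.trans (Real.rpow_le_rpow_of_exponent_le (by norm_num) hcase)
    have hH1 : 1 ≤ (H.card : ℝ) ^ ((1 : ℝ) / 2) :=
      Real.one_le_rpow (by linarith) (by norm_num)
    have hexp : 1 ≤ Real.exp (c * l₀) * Real.exp (-c * x) := by
      rw [← Real.exp_add]
      exact Real.one_le_exp (by nlinarith)
    generalize (H.card : ℝ) ^ ((1 : ℝ) / 2) = r at hH1 ⊢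
    calc (A.card : ℝ) ≤ 2 ^ l₀ * 1 * 1 := by linarith
      _ ≤ 2 ^ l₀ * r * (Real.exp (c * l₀) * Real.exp (-c * x)) := by gcongr
      _ = (2 ^ l₀ * Real.exp (c * l₀)) * r * Real.exp (-c * x) := by ring
      _ ≤ _ := by
          gcongr
          linarith
end

section
/- Fix an integer k > 3 and assume Hypothesis (U-k). Then there exist constants c > 0 and C₁ ≥ 1 (depending only on k and the constant in (U-k)) such that for every set A of k-th powers and every finite arithmetic progression P = {p + r·j : 0 ≤ j < N} of integers with N ≥ 2, one has |A ∩ P| ≤ C₁·N^{1/2}·exp(−c·(log N)^{1/3}). -/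
open Finset

theorem exists_dvd_pow_minimal (k g : ℕ) (hk : 0 < k) (hg : 0 < g) :
    ∃ G : ℕ, 0 < G ∧ g ∣ G ^ k ∧ ∀ z : ℕ, g ∣ z ^ k → G ∣ z := by
  classical
  have hex : ∃ G : ℕ, 0 < G ∧ g ∣ G ^ k := ⟨g, hg, dvd_pow_self g hk.ne'⟩
  obtain ⟨hpos, hdvd⟩ := Nat.find_spec hex
  refine ⟨Nat.find hex, hpos, hdvd, fun z hz => ?_⟩
  have h1 : 0 < Nat.gcd (Nat.find hex) z := Nat.gcd_pos_of_pos_left _ hpos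
  have h2 : g ∣ Nat.gcd (Nat.find hex) z ^ k := by
    rw [← Nat.pow_gcd_pow]
    exact Nat.dvd_gcd hdvd hz
  have h3 := Nat.find_min' hex ⟨h1, h2⟩
  have h4 := Nat.gcd_le_left z hpos
  have h5 : Nat.gcd (Nat.find hex) z = Nat.find hex := le_antisymm h4 h3
  rw [← h5]
  exact Nat.gcd_dvd_right _ _

/-- There are at most `2 * Y + 1` integers whose `k`-th power is a multiple of `g` of size at most
`g * Y ^ k`. -/
theorem card_le_of_dvd_pow (k g Y : ℕ) (hk : 0 < k) (hg : 0 < g) (Z : Finset ℤ)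
    (hdvd : ∀ z ∈ Z, g ∣ z.natAbs ^ k) (hle : ∀ z ∈ Z, z.natAbs ^ k ≤ g * Y ^ k) :
    Z.card ≤ 2 * Y + 1 := by
  obtain ⟨G, hG, hgG, hmin⟩ := exists_dvd_pow_minimal k g hk hg
  have hsub : Z ⊆ (Finset.Icc (-(Y : ℤ)) Y).image (fun w => (G : ℤ) * w) := by
    intro z hz
    obtain ⟨w, rfl⟩ : (G : ℤ) ∣ z := Int.natCast_dvd.2 (hmin _ (hdvd z hz))
    have h := hle _ hz
    rw [Int.natAbs_mul, Int.natAbs_natCast, mul_pow] at h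
    have h1 : G ^ k * w.natAbs ^ k ≤ G ^ k * Y ^ k :=
      h.trans (Nat.mul_le_mul_right _ (Nat.le_of_dvd (by positivity) hgG))
    have h2 : w.natAbs ≤ Y :=
      (Nat.pow_le_pow_iff_left hk.ne').1 (Nat.le_of_mul_le_mul_left h1 (by positivity))
    exact Finset.mem_image.2 ⟨w, Finset.mem_Icc.2 (by omega), rfl⟩
  refine (Finset.card_le_card hsub).trans (Finset.card_image_le.trans ?_)
  rw [Int.card_Icc]
  omega

/-- A bound for the number of ordered pairs in `S` with the same colour. -/
theorem card_sq_le_card_mul_card_pairs {α β : Type*} [DecidableEq α] [DecidableEq β]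
    (S : Finset α) (T : Finset β) (f : α → β) (hf : ∀ a ∈ S, f a ∈ T) :
    S.card ^ 2 ≤ T.card *
      (S.card + ((S ×ˢ S).filter (fun x => x.1 ≠ x.2 ∧ f x.1 = f x.2)).card) := by
  have h1 : S.card = ∑ b ∈ T, (S.filter (fun a => f a = b)).card :=
    Finset.card_eq_sum_card_fiberwise hf
  have h2 : ((S ×ˢ S).filter (fun x => f x.1 = f x.2)).card =
      ∑ b ∈ T, (S.filter (fun a => f a = b)).card ^ 2 := by
    rw [Finset.card_eq_sum_card_fiberwise (f := fun x : α × α => f x.1) (t := T)]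
    · refine Finset.sum_congr rfl fun b _ => ?_
      rw [sq, ← Finset.card_product]
      congr 1
      ext x
      simp only [Finset.mem_filter, Finset.mem_product]
      constructor
      · rintro ⟨⟨⟨h1, h2⟩, h3⟩, h4⟩
        exact ⟨⟨h1, h4⟩, h2, h3 ▸ h4⟩
      · rintro ⟨⟨h1, h4⟩, h2, h3⟩
        exact ⟨⟨⟨h1, h2⟩, h4.trans h3.symm⟩, h4⟩
    · intro x hx
      simp only [Finset.coe_filter, Finset.mem_product, Set.mem_ofPred_eq] at hx
      exact hf _ hx.1.1
  have h3 : ((S ×ˢ S).filter (fun x => f x.1 = f x.2)).card ≤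
      S.card + ((S ×ˢ S).filter (fun x => x.1 ≠ x.2 ∧ f x.1 = f x.2)).card := by
    rw [← Finset.diag_card S]
    refine (Finset.card_le_card fun x hx => ?_).trans (Finset.card_union_le _ _)
    simp only [Finset.mem_filter, Finset.mem_product, Finset.mem_union, Finset.mem_diag] at hx ⊢
    by_cases h : x.1 = x.2
    · exact Or.inl ⟨hx.1.1, h⟩
    · exact Or.inr ⟨hx.1, h, hx.2⟩
  calc S.card ^ 2 = (∑ b ∈ T, (S.filter (fun a => f a = b)).card) ^ 2 := by rw [← h1]
    _ ≤ T.card * ∑ b ∈ T, (S.filter (fun a => f a = b)).card ^ 2 := sq_sum_le_card_mul_sum_sq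
    _ ≤ _ := by rw [← h2]; exact Nat.mul_le_mul_left _ h3

/-- Pairs of elements of `S` congruent modulo `q` and with difference less than `q * L`. -/
theorem card_sq_le_of_subset_range (N q L Q : ℕ) (hq : 0 < q) (hqQ : q ≤ Q) (hNL : N ≤ Q * L)
    (hL : 0 < L) (S : Finset ℕ) (hS : S ⊆ Finset.range N) :
    S.card ^ 2 ≤ 2 * Q * (S.card + ((S ×ˢ S).filter
      (fun x => x.1 ≠ x.2 ∧ x.1 % q = x.2 % q ∧ x.1 / q / L = x.2 / q / L)).card) := by
  have h := card_sq_le_card_mul_card_pairs S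
    (Finset.range q ×ˢ Finset.range (N / q / L + 1)) (fun j => (j % q, j / q / L)) (by
      intro j hj
      have hjN := Finset.mem_range.1 (hS hj)
      simp only [Finset.mem_product, Finset.mem_range]
      refine ⟨Nat.mod_lt _ hq, Nat.lt_succ_of_le ?_⟩
      exact Nat.div_le_div_right (Nat.div_le_div_right hjN.le))
  simp only [Prod.mk.injEq, Finset.card_product, Finset.card_range] at h
  refine h.trans (Nat.mul_le_mul_right _ ?_)
  have h1 : q * (N / q / L) ≤ Q := by
    rw [Nat.div_div_eq_div_mul]
    have h2 := Nat.div_mul_le_self N (q * L)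
    refine le_of_mul_le_mul_right (a := L) ?_ hL
    calc q * (N / (q * L)) * L = N / (q * L) * (q * L) := by ring
      _ ≤ Q * L := h2.trans hNL
  rw [mul_add, mul_one]
  omega

/-- The number of triples `(m, i, j)` with `i ≡ j` modulo `m ^ k` is controlled by the number of
rational points on the curves `y ^ k = x ^ k + r * n`. -/
theorem sum_card_pairs_le (k C M L : ℕ) (hU : Uk k C) (p r : ℤ) (hr : r ≠ 0)
    (hL : 0 < L) (S : Finset ℕ) (hS : ∀ j ∈ S, ∃ z : ℤ, p + r * j = z ^ k)
    (hgood : ∀ i ∈ S, ∀ j ∈ S, ∀ m ∈ Finset.Icc 1 M, ∀ m' ∈ Finset.Icc 1 M,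
      ((m' : ℤ) ^ k) * (p + r * i) = (m : ℤ) ^ k * (p + r * j) → m = m') :
    ∑ m ∈ Finset.Icc 1 M, ((S ×ˢ S).filter (fun x => x.1 ≠ x.2 ∧
      x.1 % (m ^ k) = x.2 % (m ^ k) ∧ x.1 / (m ^ k) / L = x.2 / (m ^ k) / L)).card ≤
      C * (2 * L) := by
  classical
  choose! z hz using hS
  rw [← Finset.card_sigma]
  set X := (Finset.Icc 1 M).sigma (fun m => (S ×ˢ S).filter (fun x => x.1 ≠ x.2 ∧
      x.1 % (m ^ k) = x.2 % (m ^ k) ∧ x.1 / (m ^ k) / L = x.2 / (m ^ k) / L)) with hX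
  let φ : (Σ _ : ℕ, ℕ × ℕ) → ℤ := fun t => ((t.2.1 / t.1 ^ k : ℕ) : ℤ) - (t.2.2 / t.1 ^ k : ℕ)
  have key : ∀ t ∈ X, t.1 ∈ Finset.Icc 1 M ∧ t.2.1 ∈ S ∧ t.2.2 ∈ S ∧ φ t ≠ 0 ∧
      φ t ∈ Finset.Ioo (-(L : ℤ)) L ∧ (t.2.1 : ℤ) = t.2.2 + (t.1 : ℤ) ^ k * φ t := by
    rintro ⟨m, i, j⟩ ht
    simp only [hX, Finset.mem_sigma, Finset.mem_filter, Finset.mem_product] at ht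
    obtain ⟨hm, ⟨hi, hj⟩, hne, hmod, hdiv⟩ := ht
    have hmpos : 0 < m ^ k := by
      have := (Finset.mem_Icc.1 hm).1
      positivity
    have e : (i : ℤ) = j + (m : ℤ) ^ k * (((i / m ^ k : ℕ) : ℤ) - (j / m ^ k : ℕ)) := by
      have h1 := Nat.div_add_mod i (m ^ k)
      have h2 := Nat.div_add_mod j (m ^ k)
      rw [hmod] at h1
      zify at h1 h2
      push_cast
      linarith
    refine ⟨hm, hi, hj, ?_, ?_, e⟩
    · intro h0
      simp only [φ] at h0
      rw [h0] at e
      simp at e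
      exact hne e
    · have a1 := Nat.div_add_mod (i / m ^ k) L
      have a2 := Nat.div_add_mod (j / m ^ k) L
      have b1 := Nat.mod_lt (i / m ^ k) hL
      have b2 := Nat.mod_lt (j / m ^ k) hL
      rw [hdiv] at a1
      simp only [φ, Finset.mem_Ioo]
      omega
  have hcard : X.card ≤ C * (X.image φ).card := by
    refine Finset.card_le_mul_card_image _ _ fun n hn => ?_
    obtain ⟨t₀, ht₀, rfl⟩ := Finset.mem_image.1 hn
    have hn0 := (key t₀ ht₀).2.2.2.1
    obtain ⟨hfin, hcd⟩ := hU (r * φ t₀) (mul_ne_zero hr hn0)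
    refine le_trans ?_ hcd
    rw [← Set.ncard_coe_finset]
    refine Set.ncard_le_ncard_of_injOn
      (fun t => ((z t.2.2 : ℚ) / (t.1 : ℚ), (z t.2.1 : ℚ) / (t.1 : ℚ))) ?_ ?_ hfin
    · intro t ht
      simp only [Finset.coe_filter, Set.mem_ofPred_eq] at ht
      obtain ⟨hm, hi, hj, -, -, e⟩ := key t ht.1
      have hm0 : (t.1 : ℚ) ≠ 0 := by
        have := (Finset.mem_Icc.1 hm).1
        positivity
      have e1 : ((z t.2.1 : ℚ)) ^ k = p + r * t.2.1 := by exact_mod_cast (hz _ hi).symm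
      have e2 : ((z t.2.2 : ℚ)) ^ k = p + r * t.2.2 := by exact_mod_cast (hz _ hj).symm
      have e3 : (t.2.1 : ℚ) = t.2.2 + (t.1 : ℚ) ^ k * φ t := by exact_mod_cast e
      simp only [Set.mem_ofPred_eq, div_pow]
      rw [e1, e2, ← ht.2, e3]
      field_simp
      push_cast
      ring
    · intro t ht t' ht' heq
      simp only [Finset.coe_filter, Set.mem_ofPred_eq] at ht ht'
      obtain ⟨hm, hi, hj, -, -, -⟩ := key t ht.1
      obtain ⟨hm', hi', hj', -, -, -⟩ := key t' ht'.1
      have hm0 : (t.1 : ℚ) ≠ 0 := by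
        have := (Finset.mem_Icc.1 hm).1
        positivity
      have hm0' : (t'.1 : ℚ) ≠ 0 := by
        have := (Finset.mem_Icc.1 hm').1
        positivity
      simp only [Prod.mk.injEq] at heq
      obtain ⟨h2, h1⟩ := heq
      have cross : ∀ i ∈ S, ∀ j ∈ S, (z i : ℚ) / (t.1 : ℚ) = (z j : ℚ) / (t'.1 : ℚ) →
          t.1 = t'.1 ∧ i = j := by
        intro i hi j hj h
        rw [div_eq_div_iff hm0 hm0'] at h
        have h3 : (t'.1 : ℤ) ^ k * (p + r * i) = (t.1 : ℤ) ^ k * (p + r * j) := by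
          rw [hz i hi, hz j hj, ← mul_pow, ← mul_pow]
          congr 1
          have : z i * (t'.1 : ℤ) = z j * t.1 := by exact_mod_cast h
          linarith
        have h4 := hgood i hi j hj t.1 hm t'.1 hm' h3
        refine ⟨h4, ?_⟩
        rw [h4] at h3
        have h5 : ((t'.1 : ℤ)) ^ k ≠ 0 := pow_ne_zero _ (by exact_mod_cast hm0')
        have h6 := mul_left_cancel₀ h5 h3
        exact_mod_cast mul_left_cancel₀ hr (add_left_cancel h6)
      obtain ⟨h3, h4⟩ := cross _ hi _ hi' h1
      obtain ⟨-, h5⟩ := cross _ hj _ hj' h2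
      obtain ⟨m, i, j⟩ := t
      obtain ⟨m', i', j'⟩ := t'
      simp only at h3 h4 h5
      subst h3 h4 h5
      rfl
  refine hcard.trans (Nat.mul_le_mul_left _ ?_)
  have hsub : X.image φ ⊆ Finset.Ioo (-(L : ℤ)) L := by
    intro n hn
    obtain ⟨t, ht, rfl⟩ := Finset.mem_image.1 hn
    exact (key t ht).2.2.2.2.1
  refine (Finset.card_le_card hsub).trans ?_
  rw [Int.card_Ioo]
  omega

/-- If two distinct terms of the progression have ratio `(m / m') ^ k` with small `m ≠ m'`, then
they are small compared with `gcd p r`. -/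
theorem natAbs_le_of_pow_mul_eq (k M N : ℕ) (hk : 0 < k) (p r : ℤ) (hr : r ≠ 0) (i j : ℕ)
    (hi : i < N) (hj : j < N) (m m' : ℕ) (hm : m ∈ Finset.Icc 1 M) (hm' : m' ∈ Finset.Icc 1 M)
    (hne : m ≠ m') (h : (m' : ℤ) ^ k * (p + r * i) = (m : ℤ) ^ k * (p + r * j)) :
    (p + r * i).natAbs ≤ Int.gcd p r * (N * M ^ (2 * k)) := by
  have hg : 0 < Int.gcd p r := Int.gcd_pos_of_ne_zero_right _ hr
  obtain ⟨p', r', hco, hp', hr'⟩ := Int.exists_gcd_one hg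
  set g := Int.gcd p r
  have hg0 : (g : ℤ) ≠ 0 := by exact_mod_cast hg.ne'
  set u : ℤ := p' + r' * i with hu
  set v : ℤ := p' + r' * j with hv
  have e1 : p + r * i = g * u := by rw [hp', hr', hu]; ring
  have e2 : p + r * j = g * v := by rw [hp', hr', hv]; ring
  rw [Finset.mem_Icc] at hm hm'
  have h1 : (m' : ℤ) ^ k * u = (m : ℤ) ^ k * v := by
    rw [e1, e2] at h
    apply mul_left_cancel₀ hg0
    linarith
  have hcop : IsCoprime r' u := by
    rw [hu, mul_comm]
    exact ((Int.isCoprime_iff_gcd_eq_one.2 hco).symm).add_mul_right_right _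
  have hdiff : (m : ℤ) ^ k - (m' : ℤ) ^ k ≠ 0 := by
    rw [sub_ne_zero]
    intro h0
    exact hne (Nat.pow_left_injective hk.ne' (by exact_mod_cast h0))
  have hdvd : r' ∣ (m : ℤ) ^ k - (m' : ℤ) ^ k := by
    refine hcop.dvd_of_dvd_mul_right ?_
    refine ⟨(m : ℤ) ^ k * (i - j), ?_⟩
    have : u - v = r' * (i - j) := by rw [hu, hv]; ring
    linear_combination (-1 : ℤ) * h1 + (m : ℤ) ^ k * this
  have hmM : m ^ k ≤ M ^ k := Nat.pow_le_pow_left hm.2 k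
  have hmM' : m' ^ k ≤ M ^ k := Nat.pow_le_pow_left hm'.2 k
  have hdle : ((m : ℤ) ^ k - (m' : ℤ) ^ k).natAbs ≤ M ^ k := by
    zify at hmM hmM'
    have a1 : (0 : ℤ) ≤ (m : ℤ) ^ k := by positivity
    have a2 : (0 : ℤ) ≤ (m' : ℤ) ^ k := by positivity
    zify
    rw [abs_le]
    constructor <;> linarith
  have hr'le : r'.natAbs ≤ M ^ k :=
    (Nat.le_of_dvd (Int.natAbs_pos.2 hdiff) (Int.natAbs_dvd_natAbs.2 hdvd)).trans hdle
  have h2 : ((m : ℤ) ^ k - (m' : ℤ) ^ k) * u = (m : ℤ) ^ k * (r' * (i - j)) := by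
    have : u - v = r' * (i - j) := by rw [hu, hv]; ring
    linear_combination (-1 : ℤ) * h1 + (m : ℤ) ^ k * this
  have h3 : u.natAbs ≤ N * M ^ (2 * k) := by
    have h4 := congrArg Int.natAbs h2
    rw [Int.natAbs_mul, Int.natAbs_mul, Int.natAbs_mul, Int.natAbs_pow, Int.natAbs_natCast] at h4
    calc u.natAbs ≤ ((m : ℤ) ^ k - (m' : ℤ) ^ k).natAbs * u.natAbs :=
          Nat.le_mul_of_pos_left _ (Int.natAbs_pos.2 hdiff)
      _ = m ^ k * (r'.natAbs * ((i : ℤ) - j).natAbs) := h4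
      _ ≤ M ^ k * (M ^ k * N) := by
          gcongr
          omega
      _ = N * M ^ (2 * k) := by rw [two_mul, pow_add]; ring
  rw [e1, Int.natAbs_mul, Int.natAbs_natCast]
  exact Nat.mul_le_mul_left _ h3

theorem card_sq_mul_le_of_good (k C M N : ℕ) (hk : 3 < k) (hM : 1 ≤ M) (hMN : M ^ (4 * k) ≤ N)
    (hU : Uk k C) (p r : ℤ) (hr : r ≠ 0) (S : Finset ℕ) (hSN : S ⊆ Finset.range N)
    (hS : ∀ j ∈ S, ∃ z : ℤ, p + r * j = z ^ k)
    (hgood : ∀ i ∈ S, ∀ j ∈ S, ∀ m ∈ Finset.Icc 1 M, ∀ m' ∈ Finset.Icc 1 M,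
      ((m' : ℤ) ^ k) * (p + r * i) = (m : ℤ) ^ k * (p + r * j) → m = m') :
    M * S.card ^ 2 ≤ (4 + 16 * C) * N := by
  set Q := M ^ k with hQ
  have hQpos : 0 < Q := by positivity
  have hQN : Q ≤ N := (Nat.pow_le_pow_right hM (by omega)).trans hMN
  have hQM : Q ^ 2 * M ≤ N := by
    rw [hQ, ← pow_mul, ← pow_succ]
    exact (Nat.pow_le_pow_right hM (by omega)).trans hMN
  set L := N / Q + 1 with hL
  have hNL : N ≤ Q * L := (Nat.lt_mul_div_succ N hQpos).le
  have hLQ : L * Q ≤ 2 * N := by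
    have := Nat.div_mul_le_self N Q
    rw [hL, add_mul]
    omega
  have h1 := sum_card_pairs_le k C M L hU p r hr (Nat.succ_pos _) S hS hgood
  have h2 := Finset.sum_le_sum fun m (hm : m ∈ Finset.Icc 1 M) =>
    card_sq_le_of_subset_range N (m ^ k) L Q
      (by have := (Finset.mem_Icc.1 hm).1; positivity)
      (Nat.pow_le_pow_left (Finset.mem_Icc.1 hm).2 k) hNL (Nat.succ_pos _) S hSN
  rw [← Finset.mul_sum, Finset.sum_add_distrib] at h2
  simp only [Finset.sum_const, Nat.card_Icc, smul_eq_mul, Nat.add_sub_cancel] at h2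
  have h3 : M * S.card ^ 2 ≤ 2 * Q * (M * S.card + C * (2 * L)) :=
    h2.trans (Nat.mul_le_mul_left _ (Nat.add_le_add_left h1 _))
  have h4 : C * (L * Q) ≤ C * (2 * N) := Nat.mul_le_mul_left _ hLQ
  have h5 : M * (4 * Q * S.card) ≤ M * (S.card ^ 2 + 4 * Q ^ 2) := by
    refine Nat.mul_le_mul_left _ ?_
    zify
    nlinarith [sq_nonneg ((S.card : ℤ) - 2 * Q)]
  nlinarith

theorem card_sq_mul_le (k C M N : ℕ) (hk : 3 < k) (hM : 1 ≤ M) (hMN : M ^ (4 * k) ≤ N)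
    (hNM : N ≤ (2 * M) ^ (4 * k)) (hU : Uk k C) (p r : ℤ) (hr : r ≠ 0) (S : Finset ℕ)
    (hSN : S ⊆ Finset.range N) (hS : ∀ j ∈ S, ∃ z : ℤ, p + r * j = z ^ k) :
    M * S.card ^ 2 ≤ (2200 + 32 * C) * N := by
  classical
  let bad : ℕ → Prop := fun i => ∃ j ∈ S, ∃ m ∈ Finset.Icc 1 M, ∃ m' ∈ Finset.Icc 1 M,
    m ≠ m' ∧ ((m' : ℤ) ^ k) * (p + r * i) = (m : ℤ) ^ k * (p + r * j)
  have hg := card_sq_mul_le_of_good k C M N hk hM hMN hU p r hr (S.filter fun i => ¬ bad i)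
    ((Finset.filter_subset _ _).trans hSN) (fun j hj => hS j (Finset.mem_filter.1 hj).1) (by
      intro i hi j hj m hm m' hm' h
      by_contra hne
      exact (Finset.mem_filter.1 hi).2
        ⟨j, (Finset.mem_filter.1 hj).1, m, hm, m', hm', hne, h⟩)
  choose! z hz using hS
  have hb : (S.filter bad).card ≤ 2 * (16 * M ^ 6) + 1 := by
    have hinj : Set.InjOn z (S.filter bad : Finset ℕ) := by
      intro i hi j hj h
      have hi' := hz i (Finset.mem_filter.1 hi).1
      have hj' := hz j (Finset.mem_filter.1 hj).1
      rw [h, ← hj'] at hi'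
      exact_mod_cast mul_left_cancel₀ hr (add_left_cancel hi')
    rw [← Finset.card_image_of_injOn hinj]
    refine card_le_of_dvd_pow k (Int.gcd p r) _ (by omega) (Int.gcd_pos_of_ne_zero_right _ hr) _
      ?_ ?_
    · intro w hw
      obtain ⟨i, hi, rfl⟩ := Finset.mem_image.1 hw
      rw [← Int.natAbs_pow, ← hz i (Finset.mem_filter.1 hi).1, ← Int.natCast_dvd]
      exact dvd_add (Int.gcd_dvd_left ..) ((Int.gcd_dvd_right ..).mul_right _)
    · intro w hw
      obtain ⟨i, hi, rfl⟩ := Finset.mem_image.1 hw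
      obtain ⟨hiS, j, hj, m, hm, m', hm', hne, h⟩ := Finset.mem_filter.1 hi
      rw [← Int.natAbs_pow, ← hz i hiS]
      refine (natAbs_le_of_pow_mul_eq k M N (by omega) p r hr i j
        (Finset.mem_range.1 (hSN hiS)) (Finset.mem_range.1 (hSN hj)) m m' hm hm' hne h).trans
        (Nat.mul_le_mul_left _ ?_)
      refine (Nat.mul_le_mul_right _ hNM).trans (le_of_eq ?_)
      rw [mul_pow, mul_pow, pow_mul 2, mul_assoc, ← pow_add, ← pow_mul M 6]
      congr 2
      ring
  have hsum : (S.filter bad).card + (S.filter fun i => ¬ bad i).card = S.card :=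
    Finset.card_filter_add_card_filter_not _
  set a := (S.filter bad).card
  set b := (S.filter fun i => ¬ bad i).card
  have hM6 : 1 ≤ M ^ 6 := Nat.one_le_pow _ _ hM
  have ha : a ≤ 33 * M ^ 6 := by omega
  have ha2 : M * a ^ 2 ≤ 1089 * N := by
    calc M * a ^ 2 ≤ M * (33 * M ^ 6) ^ 2 := by gcongr
      _ = 1089 * M ^ 13 := by ring
      _ ≤ 1089 * N :=
        Nat.mul_le_mul_left _ ((Nat.pow_le_pow_right hM (by omega)).trans hMN)
  have hab : M * (a + b) ^ 2 ≤ M * (2 * a ^ 2 + 2 * b ^ 2) := by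
    refine Nat.mul_le_mul_left _ ?_
    zify
    nlinarith [sq_nonneg ((a : ℤ) - b)]
  rw [← hsum]
  nlinarith

theorem exists_pow_le_and_le_two_mul_pow (n N : ℕ) (hn : n ≠ 0) (hN : 1 ≤ N) :
    ∃ M : ℕ, 1 ≤ M ∧ M ^ n ≤ N ∧ N ≤ (2 * M) ^ n := by
  have hM : 1 ≤ Nat.nthRoot n N := (Nat.le_nthRoot_iff hn).2 (by simpa using hN)
  refine ⟨Nat.nthRoot n N, hM, Nat.pow_nthRoot_le (Or.inl hn), ?_⟩
  refine (Nat.lt_pow_nthRoot_add_one hn N).le.trans (Nat.pow_le_pow_left (by omega) _)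

theorem le_exp_of_card_sq_mul_le (k D M N s : ℕ) (hk : 0 < k) (hN : 2 ≤ N)
    (hNM : N ≤ (2 * M) ^ (4 * k)) (h : M * s ^ 2 ≤ D * N) :
    (s : ℝ) ≤ (2 * D + 1) * (N : ℝ) ^ ((1 : ℝ) / 2) *
      Real.exp (-(Real.log 2 / (8 * k)) * (Real.logb 2 (N : ℝ)) ^ ((1 : ℝ) / 3)) := by
  have hN0 : (0 : ℝ) < N := by positivity
  have hk0 : (0 : ℝ) < k := by positivity
  have hl2 : 0 < Real.log 2 := Real.log_pos (by norm_num)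
  set l := Real.logb 2 (N : ℝ) with hl
  have hl1 : 1 ≤ l := by
    rw [hl, Real.le_logb_iff_rpow_le (by norm_num) hN0]
    simpa using (by exact_mod_cast hN : (2 : ℝ) ≤ N)
  have hlog : Real.log N = l * Real.log 2 := by
    rw [hl, Real.logb, div_mul_cancel₀ _ hl2.ne']
  have hroot : (N : ℝ) ^ ((1 : ℝ) / (4 * k)) ≤ 2 * M := by
    have h1 : (N : ℝ) ≤ (2 * (M : ℝ)) ^ (4 * k) := by exact_mod_cast hNM
    calc (N : ℝ) ^ ((1 : ℝ) / (4 * k)) ≤ ((2 * (M : ℝ)) ^ (4 * k)) ^ ((1 : ℝ) / (4 * k)) :=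
          Real.rpow_le_rpow hN0.le h1 (by positivity)
      _ = 2 * M := by
          rw [← Real.rpow_natCast, ← Real.rpow_mul (by positivity)]
          push_cast
          rw [mul_one_div_cancel (by positivity), Real.rpow_one]
  have hexp : Real.exp (-(Real.log 2 / (8 * k)) * l) ≤
      Real.exp (-(Real.log 2 / (8 * k)) * l ^ ((1 : ℝ) / 3)) := by
    rw [Real.exp_le_exp, neg_mul, neg_mul, neg_le_neg_iff]
    refine mul_le_mul_of_nonneg_left ?_ (by positivity)
    calc l ^ ((1 : ℝ) / 3) ≤ l ^ (1 : ℝ) := Real.rpow_le_rpow_of_exponent_le hl1 (by norm_num)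
      _ = l := Real.rpow_one l
  set E := Real.exp (-(Real.log 2 / (8 * k)) * l) with hE
  have hEroot : E ^ 2 * (N : ℝ) ^ ((1 : ℝ) / (4 * k)) = 1 := by
    rw [hE, ← Real.exp_nat_mul, Real.rpow_def_of_pos hN0, ← Real.exp_add, Real.exp_eq_one_iff,
      hlog]
    field_simp
    push_cast
    ring
  have hEpos : 0 < E := Real.exp_pos _
  have hsq : (s : ℝ) ^ 2 ≤ ((2 * D + 1) * (N : ℝ) ^ ((1 : ℝ) / 2) * E) ^ 2 := by
    have h1 : (M : ℝ) * s ^ 2 ≤ D * N := by exact_mod_cast h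
    have h2 : ((N : ℝ) ^ ((1 : ℝ) / 2)) ^ 2 = N := by
      rw [← Real.sqrt_eq_rpow, Real.sq_sqrt hN0.le]
    rw [mul_pow, mul_pow, h2]
    calc (s : ℝ) ^ 2 = E ^ 2 * ((N : ℝ) ^ ((1 : ℝ) / (4 * k)) * s ^ 2) := by
          rw [← mul_assoc, hEroot, one_mul]
      _ ≤ E ^ 2 * (2 * M * s ^ 2) := by gcongr
      _ ≤ E ^ 2 * (2 * D * N) := by
          refine mul_le_mul_of_nonneg_left ?_ (by positivity)
          linarith
      _ ≤ E ^ 2 * ((2 * D + 1) ^ 2 * N) := by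
          have : (0 : ℝ) ≤ D := by positivity
          gcongr
          nlinarith
      _ = (2 * D + 1) ^ 2 * N * E ^ 2 := by ring
  refine (le_of_sq_le_sq hsq (by positivity)).trans ?_
  exact mul_le_mul_of_nonneg_left hexp (by positivity)

/-- conditionally, an arithmetic progression of length `N` contains at most
`C₁·N^{1/2}·exp(−c·(log N)^{1/3})` `k`-th powers (`k > 3`). -/
theorem kth_powers_in_AP (k : ℕ) (hk : 3 < k) (C : ℕ) (hC : 1 ≤ C) (hU : Uk k C) :
    ∃ c C₁ : ℝ, 0 < c ∧ 1 ≤ C₁ ∧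
      ∀ (A : Finset ℤ), (∀ a ∈ A, ∃ m : ℤ, a = m ^ k) →
      ∀ (p r : ℤ) (N : ℕ), 2 ≤ N →
      ∀ (P : Finset ℤ), P = (Finset.range N).image (fun j : ℕ => p + r * (j : ℤ)) →
        ((A ∩ P).card : ℝ) ≤
          C₁ * (N : ℝ) ^ ((1 : ℝ) / 2) *
            Real.exp (-c * (Real.logb 2 (N : ℝ)) ^ ((1 : ℝ) / 3)) := by
  classical
  have hk0 : (0 : ℝ) < k := by
    have : 0 < k := by omega
    exact_mod_cast this
  refine ⟨Real.log 2 / (8 * k), 2 * ((2200 + 32 * C : ℕ) : ℝ) + 1,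
    div_pos (Real.log_pos (by norm_num)) (by positivity), by
      have : (0 : ℝ) ≤ ((2200 + 32 * C : ℕ) : ℝ) := Nat.cast_nonneg _
      linarith, ?_⟩
  intro A hA p r N hN P hP
  obtain ⟨M, hM, hMN, hNM⟩ := exists_pow_le_and_le_two_mul_pow (4 * k) N (by omega) (by omega)
  refine le_exp_of_card_sq_mul_le k _ M N _ (by omega) hN hNM ?_
  by_cases hr : r = 0
  · have hcard : (A ∩ P).card ≤ 1 := by
      refine Finset.card_le_one.2 fun a ha b hb => ?_
      have ha' := (Finset.mem_inter.1 ha).2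
      have hb' := (Finset.mem_inter.1 hb).2
      simp only [hP, hr, Finset.mem_image, zero_mul, add_zero] at ha' hb'
      obtain ⟨_, _, rfl⟩ := ha'
      obtain ⟨_, _, rfl⟩ := hb'
      rfl
    have hMN' : M ≤ N := (Nat.le_self_pow (by omega) M).trans hMN
    calc M * (A ∩ P).card ^ 2 ≤ N * 1 ^ 2 := by gcongr
      _ ≤ (2200 + 32 * C) * N := by nlinarith
  · set S := (Finset.range N).filter (fun j : ℕ => p + r * (j : ℤ) ∈ A) with hS
    have hsub : A ∩ P ⊆ S.image (fun j : ℕ => p + r * (j : ℤ)) := by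
      intro a ha
      obtain ⟨haA, haP⟩ := Finset.mem_inter.1 ha
      rw [hP] at haP
      obtain ⟨j, hj, rfl⟩ := Finset.mem_image.1 haP
      exact Finset.mem_image.2 ⟨j, Finset.mem_filter.2 ⟨hj, haA⟩, rfl⟩
    have hle : (A ∩ P).card ≤ S.card := (Finset.card_le_card hsub).trans Finset.card_image_le
    refine le_trans ?_ (card_sq_mul_le k C M N hk hM hMN hNM hU p r hr S
      (Finset.filter_subset _ _) fun j hj => hA _ (Finset.mem_filter.1 hj).2)
    gcongr
end

section
/- Let k ≥ 3 be an integer and C ≥ 1 a constant. Then there exists a constant c > 0 depending only on k and C such that the following holds. Let G be an abelian group in which every nonzero element has (additive) order at least k, and let A ⊆ G be a finite nonempty set such that |A ∩ (A + α₁) ∩ ⋯ ∩ (A + α_{k−1})| ≤ C for all pairwise distinct nonzero α₁, …, α_{k−1} ∈ G. Set D = A − A and P = {s ∈ D : r_{A−A}(s) ≥ |A|² / (4|D|)}. Then |D| ≥ c·|A|^{k/(k−1)} and Σ_{x ∈ D} r_{P−P}(x) ≥ c·|A|^{2k/(k−1)}. -/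
open Finset Pointwise

/-- A set of `3`-tuples all of whose ordered pairs of coordinates lie in `E` has at most
`#E ^ (3 / 2)` elements. -/
lemma card_triangles_sq_le {V : Type*} [DecidableEq V] (E : Finset (V × V))
    (S : Finset (Fin 3 → V)) (hS : ∀ f ∈ S, ∀ i j, i < j → (f i, f j) ∈ E) :
    #S ^ 2 ≤ #E ^ 3 := by
  have hsum : #S = ∑ e ∈ E, #{f ∈ S | (f 0, f 1) = e} :=
    card_eq_sum_card_fiberwise fun f hf => hS f hf 0 1 (by decide)
  have hsq : ∑ e ∈ E, #{f ∈ S | (f 0, f 1) = e} ^ 2 ≤ #(E ×ˢ E) := by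
    simp_rw [sq, ← card_product]
    rw [← card_sigma]
    refine card_le_card_of_injOn (fun t => ((t.2.1 0, t.2.1 2), (t.2.2 1, t.2.2 2))) ?_ ?_
    · rintro ⟨e, f, g⟩ h
      simp only [coe_sigma, Set.mem_sigma_iff, mem_coe, mem_product, mem_filter] at h ⊢
      exact ⟨hS f h.2.1.1 0 2 (by decide), hS g h.2.2.1 1 2 (by decide)⟩
    · rintro ⟨e, f, g⟩ h ⟨e', f', g'⟩ h' heq
      simp only [coe_sigma, Set.mem_sigma_iff, mem_coe, mem_product, mem_filter] at h h'
      obtain ⟨-, ⟨-, hf⟩, -, hg⟩ := h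
      obtain ⟨-, ⟨-, hf'⟩, -, hg'⟩ := h'
      simp only [Prod.mk.injEq] at heq
      obtain ⟨⟨h1, h2⟩, h3, h4⟩ := heq
      have hfg := hf.trans hg.symm
      have hfg' := hf'.trans hg'.symm
      simp only [Prod.mk.injEq] at hfg hfg'
      have hff : f = f' := by
        funext i; fin_cases i
        · exact h1
        · exact hfg.2.trans (h3.trans hfg'.2.symm)
        · exact h2
      have hgg : g = g' := by
        funext i; fin_cases i
        · exact hfg.1.symm.trans (h1.trans hfg'.1)
        · exact h3
        · exact h4
      subst hff hgg
      rw [← hf, ← hf']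
  calc #S ^ 2 ≤ #E * ∑ e ∈ E, #{f ∈ S | (f 0, f 1) = e} ^ 2 := by
        rw [hsum]; exact sq_sum_le_card_mul_sum_sq
    _ ≤ #E * #(E ×ˢ E) := Nat.mul_le_mul_left _ hsq
    _ = #E ^ 3 := by rw [card_product]; ring

/-- A set of `m`-tuples, `m ≥ 2`, all of whose ordered pairs of coordinates lie in `E` has at most
`#E ^ (m / 2)` elements. -/
lemma card_cliques_sq_le {V : Type*} [DecidableEq V] (E : Finset (V × V)) (m : ℕ) :
    ∀ S : Finset (Fin (m + 2) → V), (∀ f ∈ S, ∀ i j, i < j → (f i, f j) ∈ E) →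
      #S ^ 2 ≤ #E ^ (m + 2) := by
  induction m using Nat.twoStepInduction with
  | zero =>
    intro S hS
    refine Nat.pow_le_pow_left (card_le_card_of_injOn (fun f => (f 0, f 1))
      (fun f hf => hS f hf 0 1 (by decide)) fun f _ g _ h => ?_) 2
    simp only [Prod.mk.injEq] at h
    funext i; fin_cases i
    · exact h.1
    · exact h.2
  | one => exact card_triangles_sq_le E
  | more m ih _ =>
    intro S hS
    have hT := ih (S.image fun f i => f i.succ.succ) <| by
      simp only [mem_image, forall_exists_index, and_imp]
      rintro _ f hf rfl i j hij
      exact hS f hf _ _ (by simpa using hij)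
    have hcard : #S ≤ #(S.image fun f (i : Fin (m + 2)) => f i.succ.succ) * #E := by
      rw [← card_product]
      refine card_le_card_of_injOn (fun f => (fun i => f i.succ.succ, (f 0, f 1)))
        (fun f hf => ?_) fun f _ g _ h => ?_
      · exact mem_coe.2 <| mem_product.2
          ⟨mem_image_of_mem _ hf, hS f hf 0 1 (by simp)⟩
      · simp only [Prod.mk.injEq] at h
        obtain ⟨h2, h0, h1⟩ := h
        funext i
        refine Fin.cases h0 (fun i => Fin.cases h1 (fun i => ?_) i) i
        exact congrFun h2 i
    calc #S ^ 2 ≤ (#(S.image fun f (i : Fin (m + 2)) => f i.succ.succ) * #E) ^ 2 :=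
          Nat.pow_le_pow_left hcard 2
      _ = #(S.image fun f (i : Fin (m + 2)) => f i.succ.succ) ^ 2 * #E ^ 2 := by ring
      _ ≤ #E ^ (m + 2) * #E ^ 2 := Nat.mul_le_mul_right _ hT
      _ = #E ^ (m + 2 + 2) := by ring

/-- The injective `m`-tuples with entries in `Q`. -/
noncomputable def injTuples {V : Type*} [DecidableEq V] (m : ℕ) (Q : Finset V) : Finset (Fin m → V) :=
  univ.image fun (e : Fin m ↪ Q) i => (e i : V)

lemma mem_injTuples {V : Type*} [DecidableEq V] {m : ℕ} {Q : Finset V} {f : Fin m → V}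
    (hf : f ∈ injTuples m Q) : Function.Injective f ∧ ∀ i, f i ∈ Q := by
  simp only [injTuples, mem_image, mem_univ, true_and] at hf
  obtain ⟨e, rfl⟩ := hf
  exact ⟨Subtype.val_injective.comp e.injective, fun i => (e i).2⟩

lemma pow_le_card_injTuples {V : Type*} [DecidableEq V] (m : ℕ) (Q : Finset V) :
    (#Q + 1 - m) ^ m ≤ #(injTuples m Q) := by
  rw [injTuples, card_image_of_injective]
  · rw [card_univ, Fintype.card_embedding_eq, Fintype.card_coe, Fintype.card_fin]
    exact Nat.pow_sub_le_descFactorial _ _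
  · intro e e' h
    ext i
    exact congrFun h i

/-- Double counting of the tuples `(a - b₁, …, a - bₘ)`, where `b₁, …, bₘ ∈ A` are distinct
elements of `Q a`. -/
lemma exists_difference_tuples {G : Type*} [AddCommGroup G] [DecidableEq G] {m C : ℕ}
    {A : Finset G} (hA : ∀ α : Fin m → G, Function.Injective α → (∀ i, α i ≠ 0) →
      #{a ∈ A | ∀ i, a - α i ∈ A} ≤ C)
    (Q : G → Finset G) (hQA : ∀ a, Q a ⊆ A) (hQ : ∀ a, a ∉ Q a) :
    ∃ S : Finset (Fin m → G),
      (∀ f ∈ S, ∃ a ∈ A, (∀ i, a - f i ∈ Q a)) ∧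
      ∑ a ∈ A, (#(Q a) + 1 - m) ^ m ≤ C * #S := by
  set W : Finset (Σ _ : G, Fin m → G) := A.sigma fun a => injTuples m (Q a) with hW
  set φ : (Σ _ : G, Fin m → G) → Fin m → G := fun t i => t.1 - t.2 i with hφ
  have hmem : ∀ t ∈ W, t.1 ∈ A ∧ Function.Injective t.2 ∧ ∀ i, t.2 i ∈ Q t.1 := by
    intro t ht
    rw [hW, mem_sigma] at ht
    exact ⟨ht.1, mem_injTuples ht.2⟩
  refine ⟨W.image φ, ?_, ?_⟩
  · simp only [mem_image, forall_exists_index, and_imp]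
    rintro _ t ht rfl
    obtain ⟨h1, -, h3⟩ := hmem t ht
    exact ⟨t.1, h1, fun i => by simpa [hφ] using h3 i⟩
  · calc ∑ a ∈ A, (#(Q a) + 1 - m) ^ m ≤ ∑ a ∈ A, #(injTuples m (Q a)) :=
          sum_le_sum fun a _ => pow_le_card_injTuples m (Q a)
      _ = #W := (card_sigma _ _).symm
      _ ≤ C * #(W.image φ) := by
        refine card_le_mul_card_image _ _ fun α hα => ?_
        obtain ⟨t, ht, rfl⟩ := mem_image.1 hα
        obtain ⟨-, h2, h3⟩ := hmem t ht
        refine le_trans ?_ (hA (φ t) (fun i j hij => h2 (sub_right_injective hij)) fun i h0 => ?_)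
        · refine card_le_card_of_injOn Sigma.fst (fun u hu => ?_) fun u hu v hv huv => ?_
          · simp only [coe_filter, Set.mem_ofPred_eq] at hu ⊢
            obtain ⟨h4, -, h5⟩ := hmem u hu.1
            refine ⟨h4, fun i => ?_⟩
            rw [← hu.2]
            simpa [hφ] using hQA _ (h5 i)
          · simp only [coe_filter, Set.mem_ofPred_eq] at hu hv
            obtain ⟨u1, u2⟩ := u
            obtain ⟨v1, v2⟩ := v
            obtain rfl : u1 = v1 := huv
            have := hu.2.trans hv.2.symm
            congr 1
            funext i
            exact sub_right_injective (congrFun this i)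
        · have := h3 i
          rw [← sub_eq_zero.1 h0] at this
          exact hQ _ this

/-- At least three quarters of the pairs in `A × A` have a popular difference. -/
lemma three_quarters_le_card_popular {G : Type*} [AddCommGroup G] [DecidableEq G]
    {A P : Finset G}
    (hP : P = {s ∈ A - A | (#A : ℝ) ^ 2 / (4 * (#(A - A) : ℝ)) ≤
      (#{p ∈ A ×ˢ A | p.1 - p.2 = s} : ℝ)}) :
    3 / 4 * (#A : ℝ) ^ 2 ≤ ∑ a ∈ A, (#{b ∈ A | a - b ∈ P} : ℝ) := by
  obtain rfl | hne := A.eq_empty_or_nonempty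
  · simp
  have htot : (#A : ℝ) ^ 2 = ∑ s ∈ A - A, (#{p ∈ A ×ˢ A | p.1 - p.2 = s} : ℝ) := by
    rw [sq, ← Nat.cast_mul, ← card_product, ← Nat.cast_sum]
    congr 1
    refine card_eq_sum_card_fiberwise fun p hp => ?_
    rw [mem_coe, mem_product] at hp
    exact sub_mem_sub hp.1 hp.2
  have hpop : ∑ a ∈ A, (#{b ∈ A | a - b ∈ P} : ℝ) =
      ∑ s ∈ P, (#{p ∈ A ×ˢ A | p.1 - p.2 = s} : ℝ) := by
    rw [← Nat.cast_sum, ← Nat.cast_sum, ← card_sigma]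
    congr 1
    rw [card_eq_sum_card_fiberwise (f := fun t : (_ : G) × G => t.1 - t.2) (t := P)]
    · refine sum_congr rfl fun s hs => ?_
      refine card_bij' (fun t _ => (t.1, t.2)) (fun p _ => ⟨p.1, p.2⟩) ?_ ?_ ?_ ?_
      · intro t ht
        simp only [mem_filter, mem_sigma, mem_product] at ht ⊢
        exact ⟨⟨ht.1.1, ht.1.2.1⟩, ht.2⟩
      · intro p hp
        simp only [mem_filter, mem_sigma, mem_product] at hp ⊢
        exact ⟨⟨hp.1.1, hp.1.2, hp.2 ▸ hs⟩, hp.2⟩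
      · intro _ _; rfl
      · intro _ _; rfl
    · intro t ht
      simp only [coe_sigma, Set.mem_sigma_iff, mem_coe, mem_filter] at ht ⊢
      exact ht.2.2
  have hDpos : (0 : ℝ) < #(A - A) := by exact_mod_cast (hne.sub hne).card_pos
  have hsmall : ∑ s ∈ A - A with ¬ (#A : ℝ) ^ 2 / (4 * (#(A - A) : ℝ)) ≤
      (#{p ∈ A ×ˢ A | p.1 - p.2 = s} : ℝ), (#{p ∈ A ×ˢ A | p.1 - p.2 = s} : ℝ)
      ≤ (#A : ℝ) ^ 2 / 4 := by
    refine (sum_le_card_nsmul _ _ ((#A : ℝ) ^ 2 / (4 * (#(A - A) : ℝ))) fun s hs => ?_).trans ?_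
    · exact (not_le.1 (mem_filter.1 hs).2).le
    · rw [nsmul_eq_mul]
      calc _ ≤ (#(A - A) : ℝ) * ((#A : ℝ) ^ 2 / (4 * (#(A - A) : ℝ))) := by
            gcongr
            exact filter_subset _ _
        _ = (#A : ℝ) ^ 2 / 4 := by field_simp
  have hsplit := sum_filter_add_sum_filter_not (A - A)
    (fun s => (#A : ℝ) ^ 2 / (4 * (#(A - A) : ℝ)) ≤ (#{p ∈ A ×ˢ A | p.1 - p.2 = s} : ℝ))
    (fun s => (#{p ∈ A ×ˢ A | p.1 - p.2 = s} : ℝ))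
  rw [← hP, ← htot, ← hpop] at hsplit
  linarith

/-- A power mean bound: if `d` is bounded by `#A` and has average at least `3 / 4 * #A - 1`, then
the truncated powers of `d` are large in total. -/
lemma pow_le_sum_truncated_pow {V : Type*} (A : Finset V) (d : V → ℕ) {m : ℕ}
    (hm : 1 ≤ m) (hA : 8 * m ≤ #A) (hd : ∀ a ∈ A, d a ≤ #A)
    (hsum : 3 / 4 * (#A : ℝ) ^ 2 - #A ≤ ∑ a ∈ A, (d a : ℝ)) :
    ((#A : ℝ) / 8) ^ (m + 1) ≤ ((∑ a ∈ A, (d a + 1 - m) ^ m : ℕ) : ℝ) := by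
  classical
  have hn : (8 * m : ℝ) ≤ #A := by exact_mod_cast hA
  have hm' : (1 : ℝ) ≤ m := by exact_mod_cast hm
  set B := A.filter fun a => (#A : ℝ) / 4 ≤ d a with hB
  have hBcard : (#A : ℝ) / 8 ≤ #B := by
    have h1 : ∑ a ∈ B, (d a : ℝ) ≤ #B * #A := by
      rw [← nsmul_eq_mul]
      exact sum_le_card_nsmul _ _ _ fun a ha => by exact_mod_cast hd a (mem_filter.1 ha).1
    have h2 : ∑ a ∈ A with ¬ (#A : ℝ) / 4 ≤ d a, (d a : ℝ) ≤ #A * ((#A : ℝ) / 4) := by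
      refine (sum_le_card_nsmul _ _ ((#A : ℝ) / 4)
        fun a ha => (not_le.1 (mem_filter.1 ha).2).le).trans ?_
      rw [nsmul_eq_mul]
      gcongr
      exact filter_subset _ _
    have h3 := sum_filter_add_sum_filter_not A (fun a => (#A : ℝ) / 4 ≤ d a) fun a => (d a : ℝ)
    rw [← hB] at h3
    nlinarith
  have hterm : ∀ a ∈ B, ((#A : ℝ) / 8) ^ m ≤ (((d a + 1 - m) ^ m : ℕ) : ℝ) := by
    intro a ha
    rw [Nat.cast_pow]
    gcongr
    have h1 : (#A : ℝ) / 4 ≤ d a := (mem_filter.1 ha).2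
    have h2 : m ≤ d a + 1 := by
      have : (m : ℝ) ≤ d a + 1 := by linarith
      exact_mod_cast this
    rw [Nat.cast_sub h2]
    push_cast
    linarith
  calc ((#A : ℝ) / 8) ^ (m + 1) = (#A : ℝ) / 8 * ((#A : ℝ) / 8) ^ m := by ring
    _ ≤ #B * ((#A : ℝ) / 8) ^ m := by gcongr
    _ = ∑ a ∈ B, ((#A : ℝ) / 8) ^ m := by rw [sum_const, nsmul_eq_mul]
    _ ≤ ∑ a ∈ B, (((d a + 1 - m) ^ m : ℕ) : ℝ) := sum_le_sum hterm
    _ ≤ ∑ a ∈ A, (((d a + 1 - m) ^ m : ℕ) : ℝ) :=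
        sum_le_sum_of_subset_of_nonneg (filter_subset _ _) fun _ _ _ => by positivity
    _ = _ := by rw [Nat.cast_sum]

lemma mul_rpow_div_le {m : ℕ} (hm : m ≠ 0) {c n r X : ℝ} (hn : 0 ≤ n) (hX : 0 ≤ X)
    (h : c ^ m * n ^ r ≤ X ^ m) : c * n ^ (r / m) ≤ X := by
  refine le_of_pow_le_pow_left₀ hm hX ?_
  rwa [mul_pow, ← Real.rpow_mul_natCast hn, div_mul_cancel₀ _ (by exact_mod_cast hm)]

/-- The two bounds, raised to the power `m = k - 1`. -/
lemma pow_le_card_sub_and_energy {G : Type*} [AddCommGroup G] [DecidableEq G] {m C : ℕ}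
    (hm : 2 ≤ m) (hC : 1 ≤ C) {A P : Finset G} (hne : A.Nonempty)
    (hA : ∀ α : Fin m → G, Function.Injective α → (∀ i, α i ≠ 0) →
      #{a ∈ A | ∀ i, a - α i ∈ A} ≤ C)
    (hP : P = {s ∈ A - A | (#A : ℝ) ^ 2 / (4 * (#(A - A) : ℝ)) ≤
      (#{p ∈ A ×ˢ A | p.1 - p.2 = s} : ℝ)}) :
    ((#A : ℝ) / (8 * m)) ^ (m + 1) ≤ C * (#(A - A) : ℝ) ^ m ∧
    (((#A : ℝ) / (8 * m)) ^ (m + 1)) ^ 2 ≤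
      C ^ 2 * (#{p ∈ P ×ˢ P | p.1 - p.2 ∈ A - A} : ℝ) ^ m := by
  have hC' : (1 : ℝ) ≤ C := by exact_mod_cast hC
  have hm' : (2 : ℝ) ≤ m := by exact_mod_cast hm
  have hPD : P ⊆ A - A := by rw [hP]; exact filter_subset _ _
  have hpop := three_quarters_le_card_popular hP
  have hApos : (0 : ℝ) < #A := by exact_mod_cast hne.card_pos
  set E := {p ∈ P ×ˢ P | p.1 - p.2 ∈ A - A} with hE
  rcases le_or_gt (8 * m) #A with hlarge | hsmall
  · set Q : G → Finset G := fun a => {b ∈ A | a - b ∈ P}.erase a with hQ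
    have hQmem : ∀ a b, b ∈ Q a → b ∈ A ∧ a - b ∈ P := fun a b h =>
      mem_filter.1 (mem_of_mem_erase h)
    obtain ⟨S, hS, hcard⟩ := exists_difference_tuples hA Q (fun a b h => (hQmem a b h).1)
      fun a => notMem_erase _ _
    have hdeg : 3 / 4 * (#A : ℝ) ^ 2 - #A ≤ ∑ a ∈ A, (#(Q a) : ℝ) := by
      have : ∑ a ∈ A, (#{b ∈ A | a - b ∈ P} : ℝ) ≤ ∑ a ∈ A, ((#(Q a) : ℝ) + 1) :=
        sum_le_sum fun a _ => by
          have := pred_card_le_card_erase (s := {b ∈ A | a - b ∈ P}) (a := a)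
          exact_mod_cast Nat.sub_le_iff_le_add.1 this
      rw [sum_add_distrib, sum_const, nsmul_eq_mul, mul_one] at this
      linarith
    have hlow := pow_le_sum_truncated_pow A (fun a => #(Q a)) (by omega) hlarge
      (fun a _ => card_le_card fun b h => (hQmem a b h).1) hdeg
    have hlow' : ((#A : ℝ) / (8 * m)) ^ (m + 1) ≤ C * #S := by
      refine le_trans ?_ (hlow.trans (by exact_mod_cast hcard))
      gcongr
      linarith
    have hSP : ∀ f ∈ S, ∀ i, f i ∈ P := by
      intro f hf i
      obtain ⟨a, -, h⟩ := hS f hf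
      simpa using (hQmem _ _ (h i)).2
    have hSD : ∀ f ∈ S, ∀ i j, f i - f j ∈ A - A := by
      intro f hf i j
      obtain ⟨a, -, h⟩ := hS f hf
      simpa using sub_mem_sub (hQmem _ _ (h j)).1 (hQmem _ _ (h i)).1
    have hScard : #S ≤ #(A - A) ^ m := by
      have : S ⊆ Fintype.piFinset fun _ => A - A := fun f hf =>
        Fintype.mem_piFinset.2 fun i => hPD (hSP f hf i)
      simpa using card_le_card this
    have hSE : #S ^ 2 ≤ #E ^ m := by
      obtain ⟨l, rfl⟩ := Nat.exists_eq_add_of_le' hm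
      exact card_cliques_sq_le E l S fun f hf i j _ => mem_filter.2
        ⟨mem_product.2 ⟨hSP f hf i, hSP f hf j⟩, hSD f hf i j⟩
    constructor
    · refine hlow'.trans ?_
      gcongr
      exact_mod_cast hScard
    · calc _ ≤ ((C : ℝ) * #S) ^ 2 := by gcongr
        _ = C ^ 2 * (#S : ℝ) ^ 2 := by ring
        _ ≤ _ := by
          gcongr
          exact_mod_cast hSE
  · have hle : ((#A : ℝ) / (8 * m)) ^ (m + 1) ≤ 1 := by
      refine pow_le_one₀ (by positivity) ?_
      rw [div_le_one (by positivity)]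
      exact_mod_cast hsmall.le
    have hD : (1 : ℝ) ≤ #(A - A) := by exact_mod_cast (hne.sub hne).card_pos
    have hPne : P.Nonempty := by
      by_contra h
      rw [not_nonempty_iff_eq_empty] at h
      simp only [h, notMem_empty, filter_false, card_empty, Nat.cast_zero, sum_const_zero] at hpop
      nlinarith
    have hEpos : (1 : ℝ) ≤ #E := by
      obtain ⟨p, hp⟩ := hPne
      obtain ⟨a, ha⟩ := hne
      have : (p, p) ∈ E := mem_filter.2
        ⟨mem_product.2 ⟨hp, hp⟩, by simpa using sub_mem_sub ha ha⟩
      exact_mod_cast card_pos.2 ⟨_, this⟩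
    constructor
    · exact hle.trans (one_le_mul_of_one_le_of_one_le hC' (one_le_pow₀ hD))
    · exact (pow_le_one₀ (by positivity) hle).trans
        (one_le_mul_of_one_le_of_one_le (one_le_pow₀ hC') (one_le_pow₀ hEpos))

/-- if every `(k−1)`-fold intersection of distinct nonzero shifts of a finite
nonempty set `A` (in an abelian group where nonzero elements have order at least `k`) has at
most `C` elements, then `D = A − A` satisfies `|D| ≥ c·|A|^{k/(k−1)}` and the set `P` of
popular differences satisfies `Σ_{x ∈ D} r_{P−P}(x) ≥ c·|A|^{2k/(k−1)}`. -/
theorem popular_differences (k : ℕ) (hk : 3 ≤ k) (C : ℕ) (hC : 1 ≤ C) :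
    ∃ c : ℝ, 0 < c ∧
      ∀ (G : Type) [AddCommGroup G] [DecidableEq G],
      ∀ (_ : ∀ g : G, g ≠ 0 → ∀ j : ℕ, 1 ≤ j → j < k → j • g ≠ 0),
      ∀ (A : Finset G), A.Nonempty →
        (∀ α : Fin (k - 1) → G, Function.Injective α → (∀ i, α i ≠ 0) →
          (A.filter (fun a => ∀ i, a - α i ∈ A)).card ≤ C) →
      ∀ (D : Finset G), D = A - A →
      ∀ (P : Finset G),
        P = D.filter (fun s =>
          (A.card : ℝ) ^ 2 / (4 * (D.card : ℝ)) ≤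
            (((A ×ˢ A).filter (fun p => p.1 - p.2 = s)).card : ℝ)) →
        c * (A.card : ℝ) ^ ((k : ℝ) / ((k : ℝ) - 1)) ≤ (D.card : ℝ) ∧
        c * (A.card : ℝ) ^ (2 * (k : ℝ) / ((k : ℝ) - 1)) ≤
          ∑ x ∈ D, (((P ×ˢ P).filter (fun p => p.1 - p.2 = x)).card : ℝ) := by
  obtain ⟨m, rfl⟩ : ∃ m, k = m + 1 := ⟨k - 1, by omega⟩
  have hm : 2 ≤ m := by omega
  have hm0 : m ≠ 0 := by omega
  have hC' : (1 : ℝ) ≤ C := by exact_mod_cast hC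
  have hm' : (2 : ℝ) ≤ m := by exact_mod_cast hm
  set b : ℝ := C * (8 * m) ^ (m + 1) with hb
  have hb1 : 1 ≤ b := one_le_mul_of_one_le_of_one_le hC' (one_le_pow₀ (by linarith))
  have hb0 : 0 < b := by linarith
  have hcle : b⁻¹ ≤ 1 := inv_le_one_of_one_le₀ hb1
  refine ⟨b⁻¹ ^ 2, by positivity, ?_⟩
  intro G _ _ _ A hne hA D hD P hP
  subst hD
  obtain ⟨h1, h2⟩ := pow_le_card_sub_and_energy hm hC hne hA hP
  have hsum : ∑ x ∈ A - A, (#{p ∈ P ×ˢ P | p.1 - p.2 = x} : ℝ) =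
      #{p ∈ P ×ˢ P | p.1 - p.2 ∈ A - A} := by
    rw [← Nat.cast_sum, card_eq_sum_card_fiberwise (f := fun p : G × G => p.1 - p.2) (t := A - A)]
    · congr 1
      refine sum_congr rfl fun x hx => ?_
      rw [filter_filter]
      congr 1
      refine filter_congr fun p _ => ?_
      exact ⟨fun h => ⟨h ▸ hx, h⟩, fun h => h.2⟩
    · intro p hp
      exact (mem_filter.1 hp).2
  rw [hsum]
  have hcast : ((m + 1 : ℕ) : ℝ) - 1 = m := by push_cast; ring
  have h1' : b⁻¹ * (#A : ℝ) ^ (m + 1) ≤ (#(A - A) : ℝ) ^ m := by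
    rw [div_pow, div_le_iff₀ (by positivity)] at h1
    rw [inv_mul_le_iff₀ hb0, hb]
    linarith
  have h2' : b⁻¹ ^ 2 * (#A : ℝ) ^ (2 * (m + 1)) ≤
      (#{p ∈ P ×ˢ P | p.1 - p.2 ∈ A - A} : ℝ) ^ m := by
    rw [div_pow, div_pow, div_le_iff₀ (by positivity)] at h2
    rw [inv_pow, inv_mul_le_iff₀ (by positivity), hb, mul_comm 2, pow_mul, mul_pow]
    linarith
  rw [hcast]
  constructor
  · refine mul_rpow_div_le hm0 (by positivity) (by positivity) ?_
    rw [Real.rpow_natCast, ← pow_mul]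
    refine le_trans ?_ h1'
    gcongr
    exact pow_le_of_le_one (by positivity) hcle (by omega)
  · refine mul_rpow_div_le hm0 (by positivity) (by positivity) ?_
    have : (2 * ((m + 1 : ℕ) : ℝ)) = ((2 * (m + 1) : ℕ) : ℝ) := by push_cast; ring
    rw [this, Real.rpow_natCast]
    refine le_trans ?_ h2'
    gcongr
    exact pow_le_of_le_one (by positivity) (pow_le_one₀ (by positivity) hcle) hm0
end
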